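/- arXiv:2103.01729 — 2 statements merged into one kernel-verified Lean document; each statement's English description precedes it below -/
import Mathlib

section
/- Let n ≥ 3 and x ∈ Λ_n with x = b/d in lowest terms, and let p̃_{n,x} ∈ C_q^s(n,2) be the correlation induced by the canonical strategy S̃. Then p̃_{n,x} robustly self-tests S̃: p̃_{n,x} self-tests S̃, and moreover for every ε > 0 there exists δ > 0 such that, whenever p ∈ C_q(n,2) satisfies ‖p − p̃_{n,x}‖₁ ≤ δ and p is induced by a strategy S = (ψ ∈ ℂ^{d_A} ⊗ ℂ^{d_B}, {E_v, I − E_v}_{v=1}^n, {F_w, I − F_w}_{w=1}^n), the canonical strategy S̃ is a local ε-dilation of S. -/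
open scoped Matrix Kronecker ComplexOrder

noncomputable section
namespace QST

/-- Euclidean norm of a finite complex vector. -/
def evnorm {ι : Type} [Fintype ι] (v : ι → ℂ) : ℝ :=
  Real.sqrt (∑ i, ‖v i‖ ^ 2)

/-- Inner product `⟨v, w⟩`, linear in the first argument. -/
def pinner {ι : Type} [Fintype ι] (v w : ι → ℂ) : ℂ :=
  ∑ i, v i * (starRingEnd ℂ) (w i)

/-- Reduced density matrix of `ψψ*` on the first tensor factor. -/
def rhoA {dA dB : ℕ} (ψ : Fin dA × Fin dB → ℂ) : Matrix (Fin dA) (Fin dA) ℂ :=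
  Matrix.of fun a a' => ∑ b, ψ (a, b) * (starRingEnd ℂ) (ψ (a', b))

/-- Reduced density matrix of `ψψ*` on the second tensor factor. -/
def rhoB {dA dB : ℕ} (ψ : Fin dA × Fin dB → ℂ) : Matrix (Fin dB) (Fin dB) ℂ :=
  Matrix.of fun b b' => ∑ a, ψ (a, b) * (starRingEnd ℂ) (ψ (a, b'))

/-- The state-dependent seminorm `‖X‖_ρ = (tr (X* X ρ))^(1/2)`. -/
def rnorm {d : ℕ} (ρ X : Matrix (Fin d) (Fin d) ℂ) : ℝ :=
  Real.sqrt ((Xᴴ * X * ρ).trace).re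

/-- Operator (spectral) norm of a matrix. -/
def opNorm {d : ℕ} (X : Matrix (Fin d) (Fin d) ℂ) : ℝ :=
  ‖Matrix.toEuclideanCLM (𝕜 := ℂ) X‖

/-- `P = P* = P²`. -/
def IsProjection {d : ℕ} (P : Matrix (Fin d) (Fin d) ℂ) : Prop :=
  Pᴴ = P ∧ P * P = P

/-- 1-norm distance between correlations. -/
def dist1 {n k : ℕ} (p q : Fin n → Fin n → Fin k → Fin k → ℝ) : ℝ :=
  ∑ v, ∑ w, ∑ i, ∑ j, |p v w i j - q v w i j|

/-- Membership in the set `C_q(n,k)` of quantum correlations. -/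
def IsQuantumCorrelation (n k : ℕ) (p : Fin n → Fin n → Fin k → Fin k → ℝ) : Prop :=
  ∃ (dA dB : ℕ) (ψ : Fin dA × Fin dB → ℂ)
    (E : Fin n → Fin k → Matrix (Fin dA) (Fin dA) ℂ)
    (F : Fin n → Fin k → Matrix (Fin dB) (Fin dB) ℂ),
    evnorm ψ = 1 ∧ (∀ v i, (E v i).PosSemidef) ∧ (∀ v, ∑ i, E v i = 1) ∧
    (∀ w j, (F w j).PosSemidef) ∧ (∀ w, ∑ j, F w j = 1) ∧
    ∀ v w i j, (p v w i j : ℂ) = pinner ((E v i ⊗ₖ F w j).mulVec ψ) ψ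

/-- Strategy 1 (the "tilde" strategy) is a local `ε`-dilation of strategy 2. -/
def IsLocalDilation {n k : ℕ} (ε : ℝ) {d1A d1B d2A d2B : ℕ}
    (ψ1 : Fin d1A × Fin d1B → ℂ)
    (E1 : Fin n → Fin k → Matrix (Fin d1A) (Fin d1A) ℂ)
    (F1 : Fin n → Fin k → Matrix (Fin d1B) (Fin d1B) ℂ)
    (ψ2 : Fin d2A × Fin d2B → ℂ)
    (E2 : Fin n → Fin k → Matrix (Fin d2A) (Fin d2A) ℂ)
    (F2 : Fin n → Fin k → Matrix (Fin d2B) (Fin d2B) ℂ) : Prop :=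
  ∃ (kA kB : ℕ) (VA : Matrix (Fin d1A × Fin kA) (Fin d2A) ℂ)
    (VB : Matrix (Fin d1B × Fin kB) (Fin d2B) ℂ) (χ : Fin kA × Fin kB → ℂ),
    VAᴴ * VA = 1 ∧ VBᴴ * VB = 1 ∧ evnorm χ = 1 ∧
    evnorm (fun y : (Fin d1A × Fin d1B) × (Fin kA × Fin kB) =>
        ((VA ⊗ₖ VB).mulVec ψ2) ((y.1.1, y.2.1), (y.1.2, y.2.2)) - ψ1 y.1 * χ y.2) ≤ ε ∧
    ∀ (v w : Fin n) (i j : Fin k),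
      evnorm (fun y : (Fin d1A × Fin d1B) × (Fin kA × Fin kB) =>
        ((VA ⊗ₖ VB).mulVec ((E2 v i ⊗ₖ F2 w j).mulVec ψ2)) ((y.1.1, y.2.1), (y.1.2, y.2.2))
          - ((E1 v i ⊗ₖ F1 w j).mulVec ψ1) y.1 * χ y.2) ≤ ε

/-- The sequence generating `Λ_n` for `n ≥ 4`. -/
def lambdaSeq (n : ℕ) : ℕ → ℝ
  | 0 => 0
  | l + 1 => 1 + 1 / ((n : ℝ) - 1 - lambdaSeq n l)

/-- The sets `Λ_n`. -/
def Lambda (n : ℕ) : Set ℝ :=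
  if n = 3 then {3 / 2} else Set.range (lambdaSeq n)

/-- The maximally entangled state `φ_d`. -/
def phid (d : ℕ) : Fin d × Fin d → ℂ :=
  fun y => if y.1 = y.2 then (((Real.sqrt d)⁻¹ : ℝ) : ℂ) else 0

/-- The two-outcome measurement `{M, 1 - M}`. -/
def canonPair {d : ℕ} (M : Matrix (Fin d) (Fin d) ℂ) : Fin 2 → Matrix (Fin d) (Fin d) ℂ :=
  fun i => if i = 0 then M else 1 - M

section part1


lemma irred_aux {V : Type*} [AddCommGroup V] [Module ℂ V] [FiniteDimensional ℂ V] {n b d : ℕ} (hV : Module.finrank ℂ V = d) (hd : 0 < d) (hcop : Nat.Coprime b d)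
    (f : Fin n → Module.End ℂ V) (hf : ∀ v, f v * f v = f v)
    (hs : ∑ v, f v = ((b : ℂ) / d) • 1) (L : Submodule ℂ V)
    (hL : ∀ v, ∀ y ∈ L, f v y ∈ L) (hne : L ≠ ⊥) : L = ⊤ := by
  have hd' : (d : ℂ) ≠ 0 := by exact_mod_cast hd.ne'
  let g : Fin n → Module.End ℂ L := fun v => (f v).restrict (hL v)
  have hg : ∀ v, IsIdempotentElem (g v) := by
    intro v
    ext1 y
    apply Subtype.ext
    have := congrArg (fun h => h (y : V)) (hf v)
    simpa [g] using this
  have hfree : ∀ W : Submodule ℂ L, Module.Free ℂ W := fun W => Module.Free.of_divisionRing ℂ W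
  have htr : ∀ v, LinearMap.trace ℂ L (g v) = (Module.finrank ℂ (LinearMap.range (g v)) : ℂ) :=
    fun v => (LinearMap.IsIdempotentElem.isProj_range _ (hg v)).trace
  have hsum : ∑ v, g v = ((b : ℂ) / d) • (1 : Module.End ℂ L) := by
    ext1 y
    apply Subtype.ext
    have := congrArg (fun h => h (y : V)) hs
    simpa [g, LinearMap.sum_apply] using this
  have h1 := congrArg (LinearMap.trace ℂ L) hsum
  rw [map_sum, map_smul, LinearMap.trace_one, Finset.sum_congr rfl (fun v _ => htr v)] at h1
  have h2 : d * ∑ v, Module.finrank ℂ (LinearMap.range (g v)) = b * Module.finrank ℂ L := by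
    have : (d : ℂ) * ∑ v, (Module.finrank ℂ (LinearMap.range (g v)) : ℂ) = b * Module.finrank ℂ L := by
      rw [h1, smul_eq_mul]; field_simp
    exact_mod_cast this
  have h3 : d ∣ Module.finrank ℂ L :=
    (Nat.Coprime.symm hcop).dvd_of_dvd_mul_left (Dvd.intro _ h2)
  have h4 : 0 < Module.finrank ℂ L := by
    rw [Module.finrank_pos_iff]
    exact (Submodule.nontrivial_iff_ne_bot).2 hne
  apply Submodule.eq_top_of_finrank_eq
  have h5 := Submodule.finrank_le L
  rw [hV] at h5 ⊢
  exact le_antisymm h5 (Nat.le_of_dvd h4 h3)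

lemma comm_aux {V : Type*} [AddCommGroup V] [Module ℂ V] [FiniteDimensional ℂ V] {n b d : ℕ} (hV : Module.finrank ℂ V = d) (hd : 0 < d) (hcop : Nat.Coprime b d)
    (f : Fin n → Module.End ℂ V) (hf : ∀ v, f v * f v = f v)
    (hs : ∑ v, f v = ((b : ℂ) / d) • 1) (D : Module.End ℂ V)
    (hD : ∀ v, D * f v = f v * D) : ∃ μ : ℂ, D = μ • 1 := by
  have : Nontrivial V := Module.nontrivial_of_finrank_pos (R := ℂ) (by omega)
  obtain ⟨μ, hμ⟩ := Module.End.exists_eigenvalue D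
  refine ⟨μ, ?_⟩
  have := irred_aux hV hd hcop f hf hs (Module.End.eigenspace D μ) (by
    intro v y hy
    rw [Module.End.mem_eigenspace_iff] at hy ⊢
    have := congrArg (fun h => h y) (hD v)
    simp only [Module.End.mul_apply] at this
    rw [this, hy, map_smul]) hμ
  refine LinearMap.ext fun y => ?_
  have h2 : y ∈ Module.End.eigenspace D μ := by rw [this]; trivial
  rw [Module.End.mem_eigenspace_iff] at h2
  simp [h2]

lemma burnside_aux {V : Type*} [AddCommGroup V] [Module ℂ V] [FiniteDimensional ℂ V] {n b d : ℕ} (hV : Module.finrank ℂ V = d) (hd : 0 < d) (hcop : Nat.Coprime b d)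
    (f : Fin n → Module.End ℂ V) (hf : ∀ v, f v * f v = f v)
    (hs : ∑ v, f v = ((b : ℂ) / d) • 1) : Algebra.adjoin ℂ (Set.range f) = ⊤ := by
  have : Nontrivial V := Module.nontrivial_of_finrank_pos (R := ℂ) (by omega)
  set B := Algebra.adjoin ℂ (Set.range f) with hB
  have hfB : ∀ v, f v ∈ B := fun v => Algebra.subset_adjoin ⟨v, rfl⟩
  have : IsSimpleModule B V := by
    rw [isSimpleModule_iff]
    refine { exists_pair_ne := ⟨⊥, ⊤, bot_ne_top⟩, eq_bot_or_eq_top := ?_ }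
    intro L
    by_cases hL : L = ⊥
    · exact Or.inl hL
    right
    have := irred_aux hV hd hcop f hf hs (L.restrictScalars ℂ) (by
      intro v y hy
      exact L.smul_mem (⟨f v, hfB v⟩ : B) hy) (by simpa using hL)
    simpa using this
  classical
  rw [eq_top_iff]
  intro g _
  have hsc : ∀ e : Module.End B V, ∃ μ : ℂ, ∀ y, e y = μ • y := by
    intro e
    obtain ⟨μ, hμ⟩ := comm_aux hV hd hcop f hf hs (e.restrictScalars ℂ) (by
      intro v
      refine LinearMap.ext fun y => ?_
      exact e.map_smul (⟨f v, hfB v⟩ : B) y)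
    refine ⟨μ, fun y => ?_⟩
    have := congrArg (fun h => h y) hμ
    simpa using this
  let g' : Module.End (Module.End B V) V :=
    { toFun := g, map_add' := map_add g, map_smul' := by
        intro e y
        obtain ⟨μ, hμ⟩ := hsc e
        simp [Module.End.smul_def, hμ] }
  obtain ⟨r, hr⟩ := jacobson_density g' (Finset.univ.image fun i => Module.finBasis ℂ V i)
  have : g = (r : Module.End ℂ V) := by
    apply (Module.finBasis ℂ V).ext
    intro i
    have := hr (Module.finBasis ℂ V i) (by simp)
    exact this
  rw [this]; exact r.2

lemma toLin_hyps {n b d : ℕ} (P : Fin n → Matrix (Fin d) (Fin d) ℂ) (hP : ∀ v, P v * P v = P v)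
    (hs : ∑ v, P v = ((b : ℂ) / d) • 1) :
    (∀ v, Matrix.toLinAlgEquiv' (P v) * Matrix.toLinAlgEquiv' (P v) = Matrix.toLinAlgEquiv' (P v)) ∧
    ∑ v, Matrix.toLinAlgEquiv' (P v) = ((b : ℂ) / d) • (1 : Module.End ℂ (Fin d → ℂ)) := by
  constructor
  · intro v; rw [← map_mul, hP]
  · rw [← map_sum, hs, map_smul, map_one]

lemma mat_comm {n b d : ℕ} (hd : 0 < d) (hcop : Nat.Coprime b d)
    (P : Fin n → Matrix (Fin d) (Fin d) ℂ) (hP : ∀ v, P v * P v = P v)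
    (hs : ∑ v, P v = ((b : ℂ) / d) • 1) (D : Matrix (Fin d) (Fin d) ℂ)
    (hD : ∀ v, D * P v = P v * D) : ∃ μ : ℂ, D = μ • 1 := by
  obtain ⟨h1, h2⟩ := toLin_hyps P hP hs
  obtain ⟨μ, hμ⟩ := comm_aux (by simp) hd hcop (fun v => Matrix.toLinAlgEquiv' (P v)) h1 h2 (Matrix.toLinAlgEquiv' D)
    (fun v => by simp only [← map_mul, hD])
  refine ⟨μ, Matrix.toLinAlgEquiv'.injective ?_⟩
  rw [hμ, map_smul, map_one]

lemma mat_burnside {n b d : ℕ} (hd : 0 < d) (hcop : Nat.Coprime b d)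
    (P : Fin n → Matrix (Fin d) (Fin d) ℂ) (hP : ∀ v, P v * P v = P v)
    (hs : ∑ v, P v = ((b : ℂ) / d) • 1) : Algebra.adjoin ℂ (Set.range P) = ⊤ := by
  obtain ⟨h1, h2⟩ := toLin_hyps P hP hs
  have h3 := burnside_aux (by simp) hd hcop (fun v => Matrix.toLinAlgEquiv' (P v)) h1 h2
  have h4 : (Algebra.adjoin ℂ (Set.range P)).map (Matrix.toLinAlgEquiv' (R := ℂ) (n := Fin d)).toAlgHom = ⊤ := by
    rw [AlgHom.map_adjoin, ← h3]
    congr 1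
    ext y; simp
  rw [eq_top_iff]
  intro D _
  have : Matrix.toLinAlgEquiv' D ∈ (⊤ : Subalgebra ℂ (Module.End ℂ (Fin d → ℂ))) := trivial
  rw [← h4] at this
  obtain ⟨y, hy, hy2⟩ := this
  rw [← Matrix.toLinAlgEquiv'.injective hy2]; exact hy

lemma mat_commutators {n b d : ℕ} (hd : 0 < d) (hcop : Nat.Coprime b d)
    (P : Fin n → Matrix (Fin d) (Fin d) ℂ) (hP : ∀ v, P v * P v = P v)
    (hs : ∑ v, P v = ((b : ℂ) / d) • 1) (Y : Matrix (Fin d) (Fin d) ℂ) (hY : Y.trace = 0) :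
    ∃ W : Fin n → Matrix (Fin d) (Fin d) ℂ, Y = ∑ v, (W v * P v - P v * W v) := by
  let Lm : (Fin n → Matrix (Fin d) (Fin d) ℂ) →ₗ[ℂ] Matrix (Fin d) (Fin d) ℂ :=
    { toFun := fun W => ∑ v, (W v * P v - P v * W v)
      map_add' := by intro A B; rw [← Finset.sum_add_distrib]; congr 1; ext1 v; simp; noncomm_ring
      map_smul' := by intro c A; simp [Finset.smul_sum, smul_sub] }
  suffices h : Y ∈ LinearMap.range Lm by
    obtain ⟨W, hW⟩ := h; exact ⟨W, hW.symm⟩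
  by_contra hYn
  obtain ⟨f, hf1, hf2⟩ := Submodule.exists_le_ker_of_notMem hYn
  have hfr : ∀ W, f (Lm W) = 0 := fun W => hf2 ⟨W, rfl⟩
  let D : Matrix (Fin d) (Fin d) ℂ := Matrix.of fun i j => f (Matrix.single j i 1)
  have hfD : ∀ A, f A = (D * A).trace := by
    intro A
    conv_lhs => rw [Matrix.matrix_eq_sum_single A]
    simp only [map_sum, Matrix.trace, Matrix.diag, Matrix.mul_apply, D, Matrix.of_apply]
    rw [Finset.sum_comm]
    refine Finset.sum_congr rfl fun i _ => Finset.sum_congr rfl fun j _ => ?_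
    have : Matrix.single j i (A j i) = A j i • Matrix.single j i (1:ℂ) := by simp
    rw [this, map_smul, smul_eq_mul, mul_comm]
  have hcomm : ∀ v, D * P v = P v * D := by
    intro v
    rw [Matrix.ext_iff_trace_mul_right]
    intro A
    have := hfr (Pi.single v A)
    have h2 : Lm (Pi.single v A) = A * P v - P v * A := by
      change ∑ w, ((Pi.single v A : Fin n → Matrix (Fin d) (Fin d) ℂ) w * P w - P w * (Pi.single v A : Fin n → Matrix (Fin d) (Fin d) ℂ) w) = _
      rw [Finset.sum_eq_single v]
      · simp
      · intro w _ hw; simp [Pi.single_eq_of_ne hw]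
      · simp
    rw [h2, hfD, mul_sub, Matrix.trace_sub, sub_eq_zero] at this
    rw [mul_assoc, ← this, ← mul_assoc, Matrix.trace_mul_comm, mul_assoc]
  obtain ⟨μ, hμ⟩ := mat_comm hd hcop P hP hs D hcomm
  apply hf1
  rw [hfD, hμ]; simp [hY]

lemma lambda_arith {n b d : ℕ} (hn : 3 ≤ n) (x : ℝ) (hx : x ∈ Lambda n)
    (hd : 0 < d) (hcop : Nat.Coprime b d) (hbd : x = (b : ℝ) / d) :
    (n : ℝ) * d ^ 2 - n * b * d + b ^ 2 = n := by
  suffices h : ∃ b' d' : ℤ, 0 < d' ∧ IsCoprime b' d' ∧ x = (b' : ℝ) / d' ∧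
      (n : ℤ) * d' ^ 2 - n * b' * d' + b' ^ 2 = n by
    obtain ⟨b', d', h1, h2, h3, h4⟩ := h
    have hdr : (d : ℝ) ≠ 0 := by exact_mod_cast hd.ne'
    have hdr' : (d' : ℝ) ≠ 0 := by exact_mod_cast h1.ne'
    have h5 : (b : ℤ) * d' = b' * d := by
      rw [hbd] at h3
      field_simp at h3
      have : (b : ℝ) * d' = b' * d := by linarith
      exact_mod_cast this
    have hc : IsCoprime (b : ℤ) (d : ℤ) := Nat.isCoprime_iff_coprime.2 hcop
    have h6 : (d : ℤ) = d' := by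
      apply Int.dvd_antisymm (by positivity) h1.le
      · exact hc.symm.dvd_of_dvd_mul_left ⟨b', by linarith⟩
      · exact h2.symm.dvd_of_dvd_mul_left ⟨b, by linarith⟩
    have h7 : (b : ℤ) = b' := by
      rw [← h6] at h5
      exact mul_right_cancel₀ (by exact_mod_cast hd.ne') h5
    rw [← h6, ← h7] at h4
    exact_mod_cast h4
  unfold Lambda at hx
  split_ifs at hx with h3
  · refine ⟨3, 2, by norm_num, ⟨1, -1, by norm_num⟩, by simpa using hx, by rw [h3]; norm_num⟩
  · obtain ⟨l, rfl⟩ := hx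
    have hn4 : 4 ≤ n := by omega
    clear hbd hcop hd hn h3
    suffices h : ∃ b' d' : ℤ, 0 < d' ∧ 0 ≤ b' ∧ b' ≤ 2 * d' ∧ IsCoprime b' d' ∧ lambdaSeq n l = (b' : ℝ) / d' ∧
      (n : ℤ) * d' ^ 2 - n * b' * d' + b' ^ 2 = n by
      obtain ⟨b', d', h1, _, _, h2⟩ := h; exact ⟨b', d', h1, h2⟩
    induction l with
    | zero => exact ⟨0, 1, by norm_num, by norm_num, by norm_num, isCoprime_zero_left.2 isUnit_one, by simp [lambdaSeq], by ring⟩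
    | succ l ih =>
      obtain ⟨b', d', h1, h0, h2, h3, h4, h5⟩ := ih
      have hn4' : (4 : ℤ) ≤ n := by exact_mod_cast hn4
      have hpos : 0 < ((n : ℤ) - 1) * d' - b' := by nlinarith
      refine ⟨n * d' - b', (n - 1) * d' - b', hpos, by nlinarith, by nlinarith, ?_, ?_, ?_⟩
      · obtain ⟨u, w, huw⟩ := h3
        refine ⟨w + (n - 1) * u, -(w + n * u), ?_⟩
        linear_combination huw
      · rw [lambdaSeq, h4]
        have e1 : (d' : ℝ) ≠ 0 := by exact_mod_cast h1.ne'
        have e2 : ((n : ℝ) - 1) * d' - b' ≠ 0 := by exact_mod_cast hpos.ne'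
        push_cast
        have e3 : (n : ℝ) - 1 - b' / d' = (((n : ℝ) - 1) * d' - b') / d' := by field_simp
        rw [e3]
        field_simp
        ring
      · linear_combination h5


end part1

section part3
open Filter Topology

/-- Positive tracial functional on a complex star algebra. -/
structure PT {M : Type*} [Ring M] [StarRing M] [Algebra ℂ M] (σ : M →ₗ[ℂ] ℂ) : Prop where
  hstar : ∀ X, σ (star X) = (starRingEnd ℂ) (σ X)
  pos : ∀ X, 0 ≤ (σ (star X * X)).re
  tr : ∀ X Y, σ (X * Y) = σ (Y * X)

section tracial
variable {M : Type*} [Ring M] [StarRing M] [Algebra ℂ M] [StarModule ℂ M] {σ : M →ₗ[ℂ] ℂ}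

def nr (σ : M →ₗ[ℂ] ℂ) (X : M) : ℝ := Real.sqrt (σ (star X * X)).re

@[reducible] def PT.core (h : PT σ) : PreInnerProductSpace.Core ℂ M where
  inner X Y := σ (star X * Y)
  conj_inner_symm X Y := by
    rw [← h.hstar]; simp
  re_inner_nonneg X := h.pos X
  add_left X Y Z := by simp [add_mul]
  smul_left X Y r := by simp

lemma nr_nonneg (X : M) : 0 ≤ nr σ X := Real.sqrt_nonneg _

lemma nr_sq (h : PT σ) (X : M) : nr σ X ^ 2 = (σ (star X * X)).re := Real.sq_sqrt (h.pos X)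

lemma nr_cs (h : PT σ) (X Y : M) : ‖σ (star X * Y)‖ ≤ nr σ X * nr σ Y := by
  letI := h.core
  exact InnerProductSpace.Core.norm_inner_le_norm (𝕜 := ℂ) X Y

lemma nr_add (h : PT σ) (X Y : M) : nr σ (X + Y) ≤ nr σ X + nr σ Y := by
  letI := h.core
  letI : SeminormedAddCommGroup M := InnerProductSpace.Core.toSeminormedAddCommGroup (𝕜 := ℂ)
  exact norm_add_le X Y

lemma nr_neg (X : M) : nr σ (-X) = nr σ X := by simp [nr]

lemma nr_sub (h : PT σ) (X Y : M) : nr σ (X - Y) ≤ nr σ X + nr σ Y := by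
  rw [sub_eq_add_neg, ← nr_neg (σ := σ) Y]; exact nr_add h _ _

lemma nr_smul (r : ℂ) (X : M) : nr σ (r • X) = ‖r‖ * nr σ X := by
  unfold nr
  have : (σ (star (r • X) * (r • X))).re = ‖r‖ ^ 2 * (σ (star X * X)).re := by
    simp only [star_smul, smul_mul_assoc, mul_smul_comm, map_smul, smul_eq_mul]
    rw [← mul_assoc, RCLike.star_def]
    try rw [mul_comm r]
    rw [← Complex.normSq_eq_conj_mul_self, Complex.normSq_eq_norm_sq, Complex.re_ofReal_mul]
  rw [this, Real.sqrt_mul (by positivity), Real.sqrt_sq (norm_nonneg _)]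

lemma nr_star (h : PT σ) (X : M) : nr σ (star X) = nr σ X := by
  unfold nr; rw [star_star, h.tr]

/-- Positive elements relative to a functional. -/
def Pz (σ : M →ₗ[ℂ] ℂ) (T : M) : Prop := ∀ Y, 0 ≤ (σ (star Y * T * Y)).re

lemma Pz.add {T U : M} (h1 : Pz σ T) (h2 : Pz σ U) : Pz σ (T + U) := by
  intro Y
  have := add_nonneg (h1 Y) (h2 Y)
  rw [mul_add, add_mul, map_add]; simpa using this

lemma Pz.sum {ι : Type*} {s : Finset ι} {T : ι → M} (h1 : ∀ i ∈ s, Pz σ (T i)) : Pz σ (∑ i ∈ s, T i) := by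
  intro Y
  rw [Finset.mul_sum, Finset.sum_mul, map_sum, Complex.re_sum]
  exact Finset.sum_nonneg fun i hi => h1 i hi Y

lemma Pz.smul {T : M} {r : ℝ} (hr : 0 ≤ r) (h1 : Pz σ T) : Pz σ ((r : ℂ) • T) := by
  intro Y
  rw [mul_smul_comm, smul_mul_assoc, map_smul, smul_eq_mul, Complex.re_ofReal_mul]
  exact mul_nonneg hr (h1 Y)

lemma Pz.conj {T W : M} (h1 : Pz σ T) (hW : star W = W) : Pz σ (W * T * W) := by
  intro Y
  have := h1 (W * Y)
  rw [star_mul, hW] at this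
  simpa only [mul_assoc] using this

lemma Pz.one (h : PT σ) : Pz σ 1 := by
  intro Y; simpa using h.pos Y

lemma Pz.proj (h : PT σ) {q : M} (hs : star q = q) (hq : q * q = q) : Pz σ q := by
  have := (Pz.one h).conj hs
  rwa [mul_one, hq] at this

lemma proj_nr_sq (h : PT σ) {q : M} (hs : star q = q) (hq : q * q = q) (Y : M) :
    nr σ (q * Y) ^ 2 = (σ (star Y * q * Y)).re := by
  rw [nr_sq h, star_mul, hs, ← mul_assoc, mul_assoc (star Y), hq]

lemma Pz.pos_self (h : PT σ) {T : M} (h1 : Pz σ T) : 0 ≤ (σ T).re := by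
  simpa using h1 1

lemma proj_nr_le (h : PT σ) {q : M} (hs : star q = q) (hq : q * q = q) (Y : M) :
    nr σ (q * Y) ≤ nr σ Y := by
  rw [← abs_of_nonneg (nr_nonneg (σ := σ) (q * Y)), ← abs_of_nonneg (nr_nonneg (σ := σ) Y)]
  apply sq_le_sq.1
  rw [proj_nr_sq h hs hq, nr_sq h]
  have := Pz.proj (q := 1 - q) h (by simp [hs]) (by simp [mul_sub, sub_mul, hq]) Y
  rw [mul_sub, sub_mul, mul_one, map_sub, Complex.sub_re] at this
  linarith

variable {n : ℕ} {a c : Fin n → M} {x : ℝ}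

/-- The hypotheses on two families of projections. -/
structure TwoFam (a c : Fin n → M) (x : ℝ) : Prop where
  hx : 0 ≤ x
  sa : ∀ v, star (a v) = a v
  pa : ∀ v, a v * a v = a v
  sc : ∀ v, star (c v) = c v
  pc : ∀ v, c v * c v = c v
  comm : ∀ v, a v * c v = c v * a v
  suma : ∑ v, a v = (x : ℂ) • 1
  sumc : ∑ v, c v = (x : ℂ) • 1

def Zop (a c : Fin n → M) (x : ℝ) : M := (((1 + x)⁻¹ : ℝ) : ℂ) • (1 + ∑ v, a v * c v)

lemma one_add_smul_Z (h : TwoFam a c x) (T : M) (hT : T = (x : ℂ) • 1 - ∑ v, a v * c v) :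
    T = ((1 + x : ℝ) : ℂ) • (1 - Zop a c x) := by
  have h1 : ((1 + x : ℝ) : ℂ) ≠ 0 := by
    have := h.hx; exact_mod_cast (by linarith : (1 + x : ℝ) ≠ 0)
  rw [hT, Zop, smul_sub, smul_smul, Complex.ofReal_inv, mul_inv_cancel₀ h1, one_smul]
  push_cast
  rw [add_smul, one_smul]; abel

lemma sum_b (h : TwoFam a c x) : ∑ v, (1 - a v) * c v = ((1 + x : ℝ) : ℂ) • (1 - Zop a c x) := by
  apply one_add_smul_Z h
  simp [sub_mul, h.sumc]

lemma sum_e (h : TwoFam a c x) : ∑ v, a v * (1 - c v) = ((1 + x : ℝ) : ℂ) • (1 - Zop a c x) := by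
  apply one_add_smul_Z h
  simp [mul_sub, h.suma]

lemma star_Z (h : TwoFam a c x) : star (Zop a c x) = Zop a c x := by
  simp only [Zop, star_smul, star_add, star_one, star_sum, star_mul, h.sa, h.sc, RCLike.star_def, Complex.conj_ofReal]
  simp only [h.comm]

lemma proj_b (h : TwoFam a c x) (v : Fin n) : star ((1 - a v) * c v) = (1 - a v) * c v ∧
    ((1 - a v) * c v) * ((1 - a v) * c v) = (1 - a v) * c v := by
  have hc := h.comm v
  constructor
  · simp [h.sa, h.sc, mul_sub, sub_mul, hc]
  · have : c v * (1 - a v) = (1 - a v) * c v := by simp [mul_sub, sub_mul, hc]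
    rw [mul_assoc, ← mul_assoc (c v), this, mul_assoc, h.pc, ← mul_assoc]
    congr 1
    simp [mul_sub, sub_mul, h.pa]

lemma proj_e (h : TwoFam a c x) (v : Fin n) : star (a v * (1 - c v)) = a v * (1 - c v) ∧
    (a v * (1 - c v)) * (a v * (1 - c v)) = a v * (1 - c v) := by
  have hc := h.comm v
  constructor
  · simp [h.sa, h.sc, mul_sub, sub_mul, hc]
  · have : (1 - c v) * a v = a v * (1 - c v) := by simp [mul_sub, sub_mul, hc]
    rw [mul_assoc, ← mul_assoc (1 - c v), this, mul_assoc, ← mul_assoc (a v), h.pa]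
    congr 1
    simp [mul_sub, sub_mul, h.pc]

lemma proj_ac (h : TwoFam a c x) (v : Fin n) : star (a v * c v) = a v * c v ∧
    (a v * c v) * (a v * c v) = a v * c v := by
  have hc := h.comm v
  constructor
  · simp [h.sa, h.sc, hc]
  · rw [mul_assoc, ← mul_assoc (c v), ← hc, mul_assoc, h.pc, ← mul_assoc, h.pa]

lemma Pz_Z (hσ : PT σ) (h : TwoFam a c x) : Pz σ (Zop a c x) := by
  apply Pz.smul (by have := h.hx; positivity)
  exact (Pz.one hσ).add (Pz.sum fun v _ => Pz.proj hσ (proj_ac h v).1 (proj_ac h v).2)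

lemma Pz_1Z (hσ : PT σ) (h : TwoFam a c x) : Pz σ (1 - Zop a c x) := by
  have h1 : ((1 + x : ℝ) : ℂ) ≠ 0 := by
    have := h.hx; exact_mod_cast (by linarith : (1 + x : ℝ) ≠ 0)
  have : (1 - Zop a c x) = (((1 + x)⁻¹ : ℝ) : ℂ) • ∑ v, (1 - a v) * c v := by
    rw [sum_b h, smul_smul, Complex.ofReal_inv, inv_mul_cancel₀ h1, one_smul]
  rw [this]
  apply Pz.smul (by have := h.hx; positivity)
  exact Pz.sum fun v _ => Pz.proj hσ (proj_b h v).1 (proj_b h v).2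

lemma Pz_Z1Z (hσ : PT σ) (h : TwoFam a c x) : Pz σ (Zop a c x * (1 - Zop a c x)) := by
  have hs := star_Z h
  have := ((Pz_1Z hσ h).conj hs).add ((Pz_Z hσ h).conj (W := 1 - Zop a c x) (by simp [hs]))
  convert this using 1
  noncomm_ring

lemma Pz_pow_mul (hs : star (Z : M) = Z) {T : M} (hc : Commute Z T) (h0 : Pz σ T) (h1 : Pz σ (Z * T))
    (k : ℕ) : Pz σ (Z ^ k * T) := by
  obtain ⟨m, rfl | rfl⟩ := Nat.even_or_odd' k
  · have := h0.conj (W := Z ^ m) (by simp [hs])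
    rwa [mul_assoc, ← (hc.pow_left m).eq, ← mul_assoc, ← pow_add, ← two_mul] at this
  · have := h1.conj (W := Z ^ m) (by simp [hs])
    rwa [mul_assoc, mul_assoc, ← (hc.pow_left m).eq, ← mul_assoc, ← mul_assoc, ← pow_succ, ← pow_add,
      show m + 1 + m = 2 * m + 1 by ring] at this

lemma Pz_pow (hσ : PT σ) (h : TwoFam a c x) (k : ℕ) : Pz σ (Zop a c x ^ k) := by
  have := Pz_pow_mul (star_Z h) (Commute.one_right _) (Pz.one hσ) (by simpa using Pz_Z hσ h) k
  simpa using this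

lemma Pz_pow1 (hσ : PT σ) (h : TwoFam a c x) (k : ℕ) : Pz σ (Zop a c x ^ k * (1 - Zop a c x)) :=
  Pz_pow_mul (star_Z h) ((Commute.one_right _).sub_right (Commute.refl _)) (Pz_1Z hσ h) (Pz_Z1Z hσ h) k

lemma Z_contr (hσ : PT σ) (h : TwoFam a c x) (Y : M) : nr σ (Zop a c x * Y) ≤ nr σ Y := by
  rw [← abs_of_nonneg (nr_nonneg (σ := σ) (_ * Y)), ← abs_of_nonneg (nr_nonneg (σ := σ) Y)]
  apply sq_le_sq.1
  rw [nr_sq hσ, nr_sq hσ, star_mul, star_Z h]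
  have := (Pz_1Z hσ h).add (Pz_Z1Z hσ h) Y
  have e : star Y * (1 - Zop a c x + Zop a c x * (1 - Zop a c x)) * Y = star Y * Y - star Y * Zop a c x * (Zop a c x * Y) := by
    noncomm_ring
  rw [e, map_sub, Complex.sub_re] at this
  linarith

lemma Zm_contr (hσ : PT σ) (h : TwoFam a c x) (m : ℕ) (Y : M) : nr σ (Zop a c x ^ m * Y) ≤ nr σ Y := by
  induction m with
  | zero => simp
  | succ m ih => rw [pow_succ', mul_assoc]; exact (Z_contr hσ h _).trans ih

lemma s_lim (hσ : PT σ) (h : TwoFam a c x) : 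
    Tendsto (fun m => (σ (Zop a c x ^ (2 * m) * (1 - Zop a c x))).re) atTop (𝓝 0) := by
  let s : ℕ → ℝ := fun m => (σ (Zop a c x ^ m)).re
  have hdiff : ∀ m, s m - s (m + 1) = (σ (Zop a c x ^ m * (1 - Zop a c x))).re := by
    intro m; simp only [s, pow_succ, mul_sub, mul_one, map_sub, Complex.sub_re]
  have hanti : Antitone s := antitone_nat_of_succ_le fun m => by
    have := (Pz_pow1 hσ h m).pos_self hσ
    rw [← hdiff] at this; linarith
  have hbdd : BddBelow (Set.range s) := ⟨0, by rintro _ ⟨m, rfl⟩; exact (Pz_pow hσ h m).pos_self hσ⟩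
  have ht := tendsto_atTop_ciInf hanti hbdd
  have h2 := ht.sub (ht.comp (tendsto_add_atTop_nat 1))
  rw [sub_self] at h2
  have h3 := h2.comp (tendsto_id.const_mul_atTop' (show 0 < 2 by norm_num))
  refine h3.congr fun m => ?_
  rw [← hdiff]; rfl

lemma proj_Z_lim (hσ : PT σ) (h : TwoFam a c x) (q : Fin n → M) (hq1 : ∀ v, star (q v) = q v)
    (hq2 : ∀ v, q v * q v = q v) (hsum : ∑ v, q v = ((1 + x : ℝ) : ℂ) • (1 - Zop a c x)) (v : Fin n) :
    Tendsto (fun m => nr σ (q v * Zop a c x ^ m)) atTop (𝓝 0) := by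
  have h1 : ∀ m, nr σ (q v * Zop a c x ^ m) ^ 2 ≤ (1 + x) * (σ (Zop a c x ^ (2 * m) * (1 - Zop a c x))).re := by
    intro m
    have : (1 + x) * (σ (Zop a c x ^ (2 * m) * (1 - Zop a c x))).re = ∑ w, nr σ (q w * Zop a c x ^ m) ^ 2 := by
      simp only [proj_nr_sq hσ (hq1 _) (hq2 _)]
      rw [← Complex.re_sum, ← map_sum, ← Finset.sum_mul, ← Finset.mul_sum, hsum, mul_smul_comm, smul_mul_assoc,
        map_smul, smul_eq_mul, Complex.re_ofReal_mul, star_pow, star_Z h, hσ.tr (Zop a c x ^ m * _), ← mul_assoc,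
        ← pow_add, two_mul]
    rw [this]
    exact Finset.single_le_sum (f := fun w => nr σ (q w * Zop a c x ^ m) ^ 2) (fun w _ => sq_nonneg _) (Finset.mem_univ v)
  have h2 := (s_lim hσ h).const_mul (1 + x)
  rw [mul_zero] at h2
  have h3 := squeeze_zero (fun m => sq_nonneg _) h1 h2
  have h4 := h3.sqrt
  rw [Real.sqrt_zero] at h4
  refine h4.congr fun m => Real.sqrt_sq (nr_nonneg _)

lemma ac_Z_lim (hσ : PT σ) (h : TwoFam a c x) (v : Fin n) :
    Tendsto (fun m => nr σ ((a v - c v) * Zop a c x ^ m)) atTop (𝓝 0) := by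
  have h1 := proj_Z_lim hσ h (fun v => (1 - a v) * c v) (fun v => (proj_b h v).1) (fun v => (proj_b h v).2) (sum_b h) v
  have h2 := proj_Z_lim hσ h (fun v => a v * (1 - c v)) (fun v => (proj_e h v).1) (fun v => (proj_e h v).2) (sum_e h) v
  have h3 := h2.add h1
  rw [add_zero] at h3
  refine squeeze_zero (fun m => nr_nonneg _) (fun m => ?_) h3
  have : (a v - c v) * Zop a c x ^ m = a v * (1 - c v) * Zop a c x ^ m - (1 - a v) * c v * Zop a c x ^ m := by noncomm_ring
  rw [this]; exact nr_sub hσ _ _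

lemma s_lower (hσ : PT σ) (h : TwoFam a c x) (m : ℕ) :
    (σ 1).re - ∑ v, (σ ((1 - a v) * c v)).re ≤ (σ (Zop a c x ^ m)).re := by
  have hK : 0 < 1 + x := by have := h.hx; linarith
  set Z := Zop a c x with hZ
  set g : M := (((1 + x)⁻¹ : ℝ) : ℂ) • ∑ j ∈ Finset.range m, Z ^ j with hg
  set Q : M := ((1 + x : ℝ) : ℂ) • (1 - Z) with hQ
  have hk : ((1 + x : ℝ) : ℂ) ≠ 0 := by exact_mod_cast hK.ne'
  have hgQ : g * Q = 1 - Z ^ m := by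
    rw [hg, hQ, smul_mul_assoc, mul_smul_comm, smul_smul, Complex.ofReal_inv, inv_mul_cancel₀ hk, one_smul,
      geom_sum_mul_neg]
  have hsg : star g = g := by
    have hsZ : star Z = Z := star_Z h
    simp [hg, star_sum, hsZ]
  have hPg : Pz σ (Z ^ m * g) := by
    rw [hg, mul_smul_comm, Finset.mul_sum]
    apply Pz.smul (by positivity)
    apply Pz.sum
    intro j _
    rw [← pow_add]; exact Pz_pow hσ h _
  have key : ∀ v, (σ (g * ((1 - a v) * c v))).re ≤ (σ ((1 - a v) * c v)).re := by
    intro v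
    obtain ⟨hb1, hb2⟩ := proj_b h v
    have hQb : Pz σ (Q - (1 - a v) * c v) := by
      have : Q - (1 - a v) * c v = ∑ w ∈ Finset.univ.erase v, (1 - a w) * c w := by
        rw [hQ, hZ, ← sum_b h, ← Finset.add_sum_erase _ _ (Finset.mem_univ v)]; abel
      rw [this]
      exact Pz.sum fun w _ => Pz.proj hσ (proj_b h w).1 (proj_b h w).2
    set b := (1 - a v) * c v
    have e1 := hQb (g * b)
    have e2 := hPg b
    have e3 := hσ.pos (b - b * g * b)
    rw [star_mul, hsg, hb1] at e1
    rw [hb1] at e2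
    have f1 : b * g * (Q - b) * (g * b) = b * g * b - b * (Z ^ m * g) * b - b * g * b * g * b := by
      have : b * g * (Q - b) * (g * b) = b * (g * Q) * g * b - b * g * b * g * b := by noncomm_ring
      rw [this, hgQ]; noncomm_ring
    have f2 : star (b - b * g * b) * (b - b * g * b) = b - 2 • (b * g * b) + b * g * b * g * b := by
      have : star (b - b * g * b) = b - b * g * b := by simp [hsg, hb1, mul_assoc]
      rw [this]
      have : (b - b * g * b) * (b - b * g * b) = b * b - b * b * g * b - b * g * (b * b) + b * g * (b * b) * g * b := by noncomm_ring
      rw [this, hb2]; noncomm_ring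
    rw [f1] at e1
    rw [f2] at e3
    have f3 : σ (b * g * b) = σ (g * b) := by rw [mul_assoc, hσ.tr, mul_assoc, hb2]
    simp only [map_sub, map_add, map_nsmul, Complex.sub_re, Complex.add_re, f3, Complex.smul_re, smul_eq_mul] at e1 e3
    norm_num at e3
    linarith
  have hsum := Finset.sum_le_sum fun v (_ : v ∈ Finset.univ) => key v
  rw [← Complex.re_sum, ← map_sum, ← Finset.mul_sum, sum_b h, ← hZ, ← hQ, hgQ, map_sub, Complex.sub_re] at hsum
  linarith

end tracial

end part3

section part4
open Filter Topology

abbrev Md (d : ℕ) := Matrix (Fin d) (Fin d) ℂ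

/-- normalized trace -/
def trd {d : ℕ} (Y : Md d) : ℂ := Y.trace / d

structure Canon (n b d : ℕ) (x : ℝ) (Pt : Fin n → Md d) : Prop where
  hn0 : 0 < n
  hd : 0 < d
  hcop : Nat.Coprime b d
  hbd : x = (b : ℝ) / d
  sa : ∀ v, star (Pt v) = Pt v
  pp : ∀ v, Pt v * Pt v = Pt v
  hsum : ∑ v, Pt v = (x : ℂ) • 1
  arith : (n : ℝ) * d ^ 2 - n * b * d + b ^ 2 = n

section domin
variable {n b d : ℕ} {x : ℝ} {Pt : Fin n → Md d}

lemma Canon.hx (K : Canon n b d x Pt) : 0 ≤ x := by rw [K.hbd]; positivity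

lemma Canon.hsum' (K : Canon n b d x Pt) : ∑ v, Pt v = ((b : ℂ) / d) • 1 := by
  rw [K.hsum, K.hbd]; push_cast; rfl

lemma Canon.gen (K : Canon n b d x Pt) : Algebra.adjoin ℂ (Set.range Pt) = ⊤ :=
  mat_burnside K.hd K.hcop Pt K.pp K.hsum'

lemma Canon.comms (K : Canon n b d x Pt) (Y : Md d) (hY : Y.trace = 0) :
    ∃ W : Fin n → Md d, Y = ∑ v, (W v * (Pt v)ᵀ - (Pt v)ᵀ * W v) := by
  refine mat_commutators K.hd K.hcop (fun v => (Pt v)ᵀ) (fun v => ?_) ?_ Y hY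
  · rw [← Matrix.transpose_mul, K.pp]
  · rw [← Matrix.transpose_sum, K.hsum']; simp

lemma Canon.surj (K : Canon n b d x Pt) {A : Type*} [Ring A] [StarRing A] [Algebra ℂ A] 
    (π : A →⋆ₐ[ℂ] Md d) (p : Fin n → A) (hπ : ∀ v, π (p v) = Pt v) (W : Md d) : ∃ X, π X = W := by
  have : W ∈ Algebra.adjoin ℂ (Set.range Pt) := by rw [K.gen]; trivial
  have h2 : Algebra.adjoin ℂ (Set.range Pt) ≤ π.toAlgHom.range := by
    rw [Algebra.adjoin_le_iff]
    rintro _ ⟨v, rfl⟩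
    exact ⟨p v, hπ v⟩
  exact h2 this

def bdd {M : Type*} [Ring M] [StarRing M] [Algebra ℂ M] (σ : M →ₗ[ℂ] ℂ) (X : M) : Prop :=
  ∃ C : ℝ, 0 ≤ C ∧ ∀ Y, nr σ (X * Y) ≤ C * nr σ Y

lemma bdd.add {M : Type*} [Ring M] [StarRing M] [Algebra ℂ M] [StarModule ℂ M] {σ : M →ₗ[ℂ] ℂ} (hσ : PT σ) {X Y : M}
   (h1 : bdd σ X) (h2 : bdd σ Y) : bdd σ (X + Y) := by
  obtain ⟨C, hC, h1⟩ := h1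
  obtain ⟨D, hD, h2⟩ := h2
  refine ⟨C + D, by positivity, fun T => ?_⟩
  rw [add_mul, add_mul]
  exact (nr_add hσ _ _).trans (add_le_add (h1 T) (h2 T))

lemma bdd.mul {M : Type*} [Ring M] [StarRing M] [Algebra ℂ M] {σ : M →ₗ[ℂ] ℂ} {X Y : M}
   (h1 : bdd σ X) (h2 : bdd σ Y) : bdd σ (X * Y) := by
  obtain ⟨C, hC, h1⟩ := h1
  obtain ⟨D, hD, h2⟩ := h2
  refine ⟨C * D, by positivity, fun T => ?_⟩
  rw [mul_assoc, mul_assoc]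
  exact (h1 _).trans (mul_le_mul_of_nonneg_left (h2 T) hC)

lemma bdd.tendsto {M : Type*} [Ring M] [StarRing M] [Algebra ℂ M] [StarModule ℂ M] {σ : M →ₗ[ℂ] ℂ} {X : M} (h1 : bdd σ X)
    {Y : ℕ → M} (hY : Tendsto (fun m => nr σ (Y m)) atTop (𝓝 0)) : Tendsto (fun m => nr σ (X * Y m)) atTop (𝓝 0) := by
  obtain ⟨C, hC, h1⟩ := h1
  have := hY.const_mul C
  rw [mul_zero] at this
  exact squeeze_zero (fun _ => nr_nonneg _) (fun m => h1 _) this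

variable {A M : Type*} [Ring A] [StarRing A] [Algebra ℂ A] [StarModule ℂ A] 
  [Ring M] [StarRing M] [Algebra ℂ M] [StarModule ℂ M]

lemma dom_abs (K : Canon n b d x Pt) (dg : A →⋆ₐ[ℂ] M) (hat : Md d →⋆ₐ[ℂ] M)
    (hcomm : ∀ X B, dg X * hat B = hat B * dg X) (σ : M →ₗ[ℂ] ℂ) (hσ : PT σ)
    (p : Fin n → A) (hsa : ∀ v, star (p v) = p v) (hpp : ∀ v, p v * p v = p v)
    (hps : ∑ v, p v = (x : ℂ) • 1) (hgen : Algebra.adjoin ℂ (Set.range p) = ⊤)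
    (π : A →⋆ₐ[ℂ] Md d) (hπ : ∀ v, π (p v) = Pt v) (s : ℝ)
    (hs : s ≤ (σ 1).re - ∑ v, (σ ((1 - dg (p v)) * hat (Pt v)ᵀ)).re) (X : A) :
    s * (trd (star (π X) * π X)).re ≤ (σ (star (dg X) * dg X)).re := by
  set a : Fin n → M := fun v => dg (p v) with ha
  set c : Fin n → M := fun v => hat (Pt v)ᵀ with hc
  have hT : TwoFam a c x := 
    { hx := K.hx
      sa := fun v => by simp only [ha, ← map_star, hsa]
      pa := fun v => by simp only [ha, ← map_mul, hpp]
      sc := fun v => by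
        simp only [hc, ← map_star]
        have : star (Pt v)ᵀ = (star (Pt v))ᵀ := rfl
        rw [this, K.sa]
      pc := fun v => by simp only [hc, ← map_mul, ← Matrix.transpose_mul, K.pp]
      comm := fun v => hcomm _ _
      suma := by simp only [ha, ← map_sum, hps, map_smul, map_one]
      sumc := by simp only [hc, ← map_sum, ← Matrix.transpose_sum, K.hsum, Matrix.transpose_smul, Matrix.transpose_one, map_smul, map_one] }
  set Z := Zop a c x with hZ
  have hZs : ∀ m, star (Z ^ m) = Z ^ m := fun m => by rw [star_pow, star_Z hT]
  have hsm : ∀ m, s ≤ (σ (Z ^ m)).re := fun m => hs.trans (s_lower hσ hT m)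
  have main : ∀ X : A, bdd σ (dg X) ∧ bdd σ (hat (π X)ᵀ) ∧
      Tendsto (fun m => nr σ ((dg X - hat (π X)ᵀ) * Z ^ m)) atTop (𝓝 0) := by
    intro X
    have hX : X ∈ Algebra.adjoin ℂ (Set.range p) := by rw [hgen]; trivial
    induction hX using Algebra.adjoin_induction with
    | mem X hX =>
      obtain ⟨v, rfl⟩ := hX
      refine ⟨⟨1, zero_le_one, fun Y => ?_⟩, ⟨1, zero_le_one, fun Y => ?_⟩, ?_⟩
      · rw [one_mul]; exact proj_nr_le hσ (hT.sa v) (hT.pa v) Y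
      · rw [one_mul, hπ]; exact proj_nr_le hσ (hT.sc v) (hT.pc v) Y
      · rw [hπ]; exact ac_Z_lim hσ hT v
    | algebraMap r =>
      have h1 : dg (algebraMap ℂ A r) = r • 1 := by rw [Algebra.algebraMap_eq_smul_one, map_smul, map_one]
      have h2 : hat (π (algebraMap ℂ A r))ᵀ = r • 1 := by
        rw [Algebra.algebraMap_eq_smul_one, map_smul, map_one, Matrix.transpose_smul, Matrix.transpose_one, map_smul, map_one]
      have h3 : bdd σ (r • (1 : M)) := ⟨‖r‖, norm_nonneg _, fun Y => by rw [smul_mul_assoc, one_mul, nr_smul]⟩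
      rw [h1, h2]
      refine ⟨h3, h3, ?_⟩
      simp [nr]
    | add X Y _ _ h1 h2 =>
      obtain ⟨h1, h1', h1''⟩ := h1
      obtain ⟨h2, h2', h2''⟩ := h2
      rw [map_add, map_add, Matrix.transpose_add, map_add]
      refine ⟨h1.add hσ h2, h1'.add hσ h2', ?_⟩
      have := h1''.add h2''
      rw [add_zero] at this
      refine squeeze_zero (fun _ => nr_nonneg _) (fun m => ?_) this
      refine le_trans (le_of_eq ?_) (nr_add hσ _ _)
      congr 1; noncomm_ring
    | mul X Y _ _ h1 h2 =>
      obtain ⟨h1, h1', h1''⟩ := h1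
      obtain ⟨h2, h2', h2''⟩ := h2
      rw [map_mul, map_mul, Matrix.transpose_mul, map_mul]
      refine ⟨h1.mul h2, h2'.mul h1', ?_⟩
      have := (h1.tendsto h2'').add (h2'.tendsto h1'')
      rw [add_zero] at this
      refine squeeze_zero (fun _ => nr_nonneg _) (fun m => ?_) this
      refine le_trans (le_of_eq ?_) (nr_add hσ _ _)
      congr 1
      have := hcomm X (π Y)ᵀ
      calc (dg X * dg Y - hat (π Y)ᵀ * hat (π X)ᵀ) * Z ^ m = (dg X * dg Y - dg X * hat (π Y)ᵀ + hat (π Y)ᵀ * dg X - hat (π Y)ᵀ * hat (π X)ᵀ) * Z ^ m := by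
            rw [this]; congr 1; abel
        _ = _ := by noncomm_ring
  have hZr : ∀ (T : M) m, nr σ (T * Z ^ m) ≤ nr σ T := by
    intro T m
    rw [← nr_star hσ, star_mul, hZs, ← nr_star hσ T]
    exact Zm_contr hσ hT m _
  -- commutators
  have hcm : ∀ (W : Md d) v, Tendsto (fun m => σ (Z ^ m * hat (W * (Pt v)ᵀ - (Pt v)ᵀ * W) * Z ^ m)) atTop (𝓝 0) := by
    intro W v
    have e : ∀ m, Z ^ m * hat (W * (Pt v)ᵀ - (Pt v)ᵀ * W) * Z ^ m = star ((a v - c v) * Z ^ m) * (hat W * Z ^ m) 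
        - star (star (hat W) * Z ^ m) * ((a v - c v) * Z ^ m) := by
      intro m
      rw [star_mul, star_mul, hZs, star_star, star_sub, hT.sa, hT.sc, map_sub, map_mul, map_mul]
      have := hcomm (p v) W
      have h2 : hat W * c v - c v * hat W = (a v - c v) * hat W - hat W * (a v - c v) := by
        rw [sub_mul, mul_sub, ← this]; abel
      change Z ^ m * (hat W * c v - c v * hat W) * Z ^ m = _
      rw [h2]; noncomm_ring
    have h0 := ac_Z_lim hσ hT v
    have h1 := h0.mul_const (nr σ (hat W))
    have h2 := h0.const_mul (nr σ (star (hat W)))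
    have h3 := h1.add h2
    rw [zero_mul, mul_zero, add_zero] at h3
    refine squeeze_zero_norm (fun m => ?_) h3
    rw [e, map_sub]
    refine (norm_sub_le _ _).trans (add_le_add ?_ ?_)
    · exact (nr_cs hσ _ _).trans (mul_le_mul_of_nonneg_left (hZr _ _) (nr_nonneg _))
    · exact (nr_cs hσ _ _).trans (mul_le_mul_of_nonneg_right (hZr _ _) (nr_nonneg _))
  have hY : ∀ Y : Md d, Tendsto (fun m => σ (Z ^ m * hat Y * Z ^ m) - trd Y * σ (Z ^ (2 * m))) atTop (𝓝 0) := by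
    intro Y
    have hd0 : (d : ℂ) ≠ 0 := by exact_mod_cast K.hd.ne'
    obtain ⟨W, hW⟩ := K.comms (Y - trd Y • 1) (by
      rw [Matrix.trace_sub, Matrix.trace_smul, Matrix.trace_one, trd]; simp; field_simp; simp)
    have h1 := tendsto_finsetSum Finset.univ (fun v _ => hcm (W v) v)
    rw [Finset.sum_const_zero] at h1
    refine h1.congr fun m => ?_
    rw [← map_sum, ← Finset.sum_mul, ← Finset.mul_sum, ← map_sum, ← hW, map_sub, map_smul, map_one, mul_sub, sub_mul, map_sub,
      mul_smul_comm, smul_mul_assoc, map_smul, smul_eq_mul, mul_one, ← pow_add, two_mul]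
  set B := (π X)ᵀ with hB
  obtain ⟨_, _, hX⟩ := main X
  have hlim := hY (star B * B)
  have htr : trd (star B * B) = trd (star (π X) * π X) := by
    have : star B * B = (π X * star (π X))ᵀ := by rw [Matrix.transpose_mul]; rfl
    rw [this, trd, trd, Matrix.trace_transpose, Matrix.trace_mul_comm]
  rw [htr] at hlim
  have him : (trd (star (π X) * π X)).im = 0 := by
    have := (Matrix.posSemidef_conjTranspose_mul_self (π X)).trace_nonneg
    have h3 : 0 ≤ trd (star (π X) * π X) := by
      unfold trd; exact div_nonneg this (by exact_mod_cast (Nat.zero_le d))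
    exact (Complex.nonneg_iff.1 h3).2.symm
  have hre : 0 ≤ (trd (star (π X) * π X)).re := by
    have := (Matrix.posSemidef_conjTranspose_mul_self (π X)).trace_nonneg
    have h3 : 0 ≤ trd (star (π X) * π X) := by
      unfold trd; exact div_nonneg this (by exact_mod_cast (Nat.zero_le d))
    exact (Complex.nonneg_iff.1 h3).1
  have hlim2 := (Complex.continuous_re.tendsto _).comp hlim
  have hb : ∀ m, s * (trd (star (π X) * π X)).re ≤ 
      (nr σ (dg X) + nr σ ((dg X - hat B) * Z ^ m)) ^ 2 - (σ (Z ^ m * hat (star B * B) * Z ^ m) - trd (star (π X) * π X) * σ (Z ^ (2 * m))).re := by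
    intro m
    have h1 : nr σ (hat B * Z ^ m) ≤ nr σ (dg X) + nr σ ((dg X - hat B) * Z ^ m) := by
      have : hat B * Z ^ m = dg X * Z ^ m - (dg X - hat B) * Z ^ m := by noncomm_ring
      rw [this]
      exact (nr_sub hσ _ _).trans (by gcongr; exact hZr _ _)
    have h2 := pow_le_pow_left₀ (nr_nonneg _) h1 2
    rw [nr_sq hσ, star_mul, hZs, ← map_star] at h2
    have h3 : Z ^ m * hat (star B) * (hat B * Z ^ m) = Z ^ m * hat (star B * B) * Z ^ m := by rw [map_mul]; noncomm_ring
    rw [h3] at h2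
    rw [Complex.sub_re, Complex.mul_re, him, zero_mul, sub_zero]
    have h4 := mul_le_mul_of_nonneg_left (hsm (2 * m)) hre
    linarith
  have hfin := ((hX.const_add (nr σ (dg X))).pow 2).sub hlim2
  simp only [Complex.zero_re, sub_zero, add_zero] at hfin
  rw [nr_sq hσ] at hfin
  exact ge_of_tendsto' hfin hb

end domin

end part4

section part5
open Filter Topology
section domin
variable {n b d : ℕ} {x : ℝ} {Pt : Fin n → Md d}
variable {A : Type*} [Ring A] [StarRing A] [Algebra ℂ A] [StarModule ℂ A] 

def sgm (d : ℕ) (τ : A →ₗ[ℂ] ℂ) : Matrix (Fin d) (Fin d) A →ₗ[ℂ] ℂ :=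
  (d : ℂ)⁻¹ • (τ ∘ₗ Matrix.traceLinearMap (Fin d) ℂ A)

lemma sgm_apply (τ : A →ₗ[ℂ] ℂ) (X : Matrix (Fin d) (Fin d) A) : sgm d τ X = (d : ℂ)⁻¹ * ∑ i, τ (X i i) := by
  simp [sgm, Matrix.trace]

lemma PT_sgm {τ : A →ₗ[ℂ] ℂ} (h : PT τ) : PT (sgm d τ) where
  hstar X := by
    simp only [sgm_apply, map_mul, map_sum, Matrix.star_apply, h.hstar]
    simp
  pos X := by
    rw [sgm_apply]
    simp only [Matrix.mul_apply, Matrix.star_apply, map_sum]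
    have : ((d : ℂ)⁻¹) = (((d : ℝ)⁻¹ : ℝ) : ℂ) := by simp
    rw [this, Complex.re_ofReal_mul]
    refine mul_nonneg (by positivity) ?_
    rw [Complex.re_sum]
    refine Finset.sum_nonneg fun i _ => ?_
    rw [Complex.re_sum]
    exact Finset.sum_nonneg fun j _ => h.pos _
  tr X Y := by
    simp only [sgm_apply, Matrix.mul_apply, map_sum]
    rw [Finset.sum_comm]
    congr 1
    refine Finset.sum_congr rfl fun i _ => Finset.sum_congr rfl fun j _ => ?_
    rw [h.tr]

def dgA (d : ℕ) (A : Type*) [Ring A] [StarRing A] [Algebra ℂ A] : A →⋆ₐ[ℂ] Matrix (Fin d) (Fin d) A :=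
  { Matrix.scalarAlgHom (Fin d) ℂ with
    map_star' := fun X => by
      simp [Matrix.star_eq_conjTranspose, Matrix.diagonal_conjTranspose] }

lemma dgA_apply (X : A) : dgA d A X = Matrix.diagonal (fun _ => X) := by
  change Matrix.scalarAlgHom (Fin d) ℂ X = _
  rw [Matrix.scalarAlgHom_apply]; rfl

def hatA (d : ℕ) (A : Type*) [Ring A] [StarRing A] [Algebra ℂ A] [StarModule ℂ A] : Md d →⋆ₐ[ℂ] Matrix (Fin d) (Fin d) A :=
  { (Algebra.ofId ℂ A).mapMatrix with
    map_star' := fun X => by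
      ext i j
      simp only [AlgHom.toRingHom_eq_coe, RingHom.toMonoidHom_eq_coe, OneHom.toFun_eq_coe, MonoidHom.toOneHom_coe, MonoidHom.coe_coe, RingHom.coe_coe, AlgHom.mapMatrix_apply, Matrix.map_apply, Matrix.star_apply]
      exact algebraMap_star_comm _ }

lemma hatA_apply (X : Md d) (i j : Fin d) : hatA d A X i j = algebraMap ℂ A (X i j) := rfl

def tv (Pt : Fin n → Md d) (v : Fin n) : ℝ := (trd (Pt v)).re

lemma Canon.trd_eq (K : Canon n b d x Pt) (v : Fin n) : trd (Pt v) = (tv Pt v : ℂ) := by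
  have h : (starRingEnd ℂ) (trd (Pt v)) = trd (Pt v) := by
    unfold trd
    rw [map_div₀, map_natCast]
    have := Matrix.trace_conjTranspose (Pt v)
    rw [← Matrix.star_eq_conjTranspose, K.sa] at this
    rw [starRingEnd_apply, ← this]
  exact (Complex.conj_eq_iff_re.1 h).symm

lemma Canon.tv_sum (K : Canon n b d x Pt) : ∑ v, tv Pt v = x := by
  have hd0 : (d : ℂ) ≠ 0 := by exact_mod_cast K.hd.ne'
  have : ((∑ v, tv Pt v : ℝ) : ℂ) = x := by
    push_cast
    simp only [← K.trd_eq, trd]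
    rw [← Finset.sum_div, ← Matrix.trace_sum, K.hsum, Matrix.trace_smul, Matrix.trace_one]
    simp [hd0]
  exact_mod_cast this

lemma Canon.lower (K : Canon n b d x Pt) : 1 / (d : ℝ) ^ 2 ≤ 1 - ∑ v, (tv Pt v - tv Pt v ^ 2) := by
  have hd0 : (d : ℝ) ≠ 0 := by exact_mod_cast K.hd.ne'
  have hdp : (0 : ℝ) < d := by exact_mod_cast K.hd
  have h1 := sq_sum_le_card_mul_sum_sq (s := Finset.univ) (f := tv Pt)
  rw [K.tv_sum, Finset.card_univ, Fintype.card_fin] at h1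
  rw [Finset.sum_sub_distrib, K.tv_sum]
  have har := K.arith
  have hb : (b : ℝ) = x * d := by rw [K.hbd]; field_simp
  rw [hb] at har
  have hn : (0 : ℝ) < n := by exact_mod_cast K.hn0
  have h2 : (n : ℝ) * (1 / (d : ℝ) ^ 2) ≤ n * (1 - (x - ∑ v, tv Pt v ^ 2)) := by
    have : (n : ℝ) * (1 / (d : ℝ) ^ 2) = n - n * x + x ^ 2 := by
      field_simp
      nlinarith
    rw [this]; nlinarith
  exact le_of_mul_le_mul_left h2 hn

lemma domination (K : Canon n b d x Pt) 
    (p : Fin n → A) (hsa : ∀ v, star (p v) = p v) (hpp : ∀ v, p v * p v = p v)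
    (hps : ∑ v, p v = (x : ℂ) • 1) (hgen : Algebra.adjoin ℂ (Set.range p) = ⊤)
    (π : A →⋆ₐ[ℂ] Md d) (hπ : ∀ v, π (p v) = Pt v) (τ : A →ₗ[ℂ] ℂ) (hτ : PT τ)
    (hm : ∀ v, τ (p v) = τ 1 * tv Pt v) (X : A) :
    (τ 1).re / (d : ℝ) ^ 2 * (trd (star (π X) * π X)).re ≤ (τ (star X * X)).re := by
  have hd0 : (d : ℂ) ≠ 0 := by exact_mod_cast K.hd.ne'
  have hdg : ∀ Y, sgm d τ (dgA d A Y) = τ Y := by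
    intro Y; rw [sgm_apply, dgA_apply]; simp [hd0]
  have hhat : ∀ (Y : A) (B : Md d), sgm d τ (dgA d A Y * hatA d A B) = τ Y * trd B := by
    intro Y B
    rw [sgm_apply, dgA_apply]
    have : ∀ i, τ (((Matrix.diagonal (fun _ => Y) : Matrix (Fin d) (Fin d) A) * hatA d A B) i i) = τ Y * B i i := by
      intro i
      rw [Matrix.diagonal_mul, hatA_apply, Algebra.algebraMap_eq_smul_one, mul_smul_comm, mul_one, map_smul, smul_eq_mul, mul_comm]
    simp only [this]
    rw [← Finset.mul_sum, trd, Matrix.trace]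
    simp only [Matrix.diag_apply]
    field_simp
  have hpos : 0 ≤ (τ 1).re := by simpa using hτ.pos 1
  have := dom_abs K (dgA d A) (hatA d A) (fun X B => ?_) (sgm d τ) (PT_sgm hτ) p hsa hpp hps hgen π hπ ((τ 1).re / (d : ℝ) ^ 2) ?_ X
  · rwa [← map_star (dgA d A), ← map_mul (dgA d A), hdg] at this
  · ext i j
    rw [dgA_apply, Matrix.diagonal_mul, Matrix.mul_diagonal, hatA_apply, Algebra.commutes]
  · have h1 : ∀ v, (sgm d τ ((1 - dgA d A (p v)) * hatA d A (Pt v)ᵀ)).re = (τ 1).re * (tv Pt v - tv Pt v ^ 2) := by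
      intro v
      rw [← map_one (dgA d A), ← map_sub, hhat, map_sub, hm]
      have : trd (Pt v)ᵀ = tv Pt v := by rw [← K.trd_eq, trd, trd, Matrix.trace_transpose]
      rw [this]
      have : (τ 1 - τ 1 * (tv Pt v : ℂ)) * (tv Pt v : ℂ) = ((tv Pt v - tv Pt v ^ 2 : ℝ) : ℂ) * τ 1 := by push_cast; ring
      rw [this, Complex.re_ofReal_mul, mul_comm]
    simp only [h1]
    rw [← map_one (dgA d A), hdg, ← Finset.mul_sum]
    have := mul_le_mul_of_nonneg_left K.lower hpos
    rw [mul_sub, mul_one] at this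
    rwa [div_eq_mul_one_div]

end domin

end part5

section part6
open Filter Topology
section uniq
variable {n b d : ℕ} {x : ℝ} {Pt : Fin n → Md d}
variable {A : Type*} [Ring A] [StarRing A] [Algebra ℂ A] [StarModule ℂ A] 

lemma trd_add (X Y : Md d) : trd (X + Y) = trd X + trd Y := by simp [trd, Matrix.trace_add, add_div]
lemma trd_smul (r : ℂ) (X : Md d) : trd (r • X) = r * trd X := by simp [trd, mul_div_assoc]
lemma trd_star (X : Md d) : trd (star X) = (starRingEnd ℂ) (trd X) := by
  simp [trd, Matrix.star_eq_conjTranspose, Matrix.trace_conjTranspose]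
lemma trd_comm (X Y : Md d) : trd (X * Y) = trd (Y * X) := by simp [trd, Matrix.trace_mul_comm X]
lemma trd_one (hd : 0 < d) : trd (1 : Md d) = 1 := by
  have hd0 : (d : ℂ) ≠ 0 := by exact_mod_cast hd.ne'
  simp [trd, hd0]

def trp (π : A →⋆ₐ[ℂ] Md d) : A →ₗ[ℂ] ℂ where
  toFun X := trd (π X)
  map_add' X Y := by rw [map_add, trd_add]
  map_smul' r X := by rw [map_smul, trd_smul]; rfl

lemma unique_exact (K : Canon n b d x Pt) 
    (p : Fin n → A) (hsa : ∀ v, star (p v) = p v) (hpp : ∀ v, p v * p v = p v)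
    (hps : ∑ v, p v = (x : ℂ) • 1) (hgen : Algebra.adjoin ℂ (Set.range p) = ⊤)
    (π : A →⋆ₐ[ℂ] Md d) (hπ : ∀ v, π (p v) = Pt v) (τ : A →ₗ[ℂ] ℂ) (hτ : PT τ) (h1 : τ 1 = 1)
    (hm : ∀ v, τ (p v) = tv Pt v) (X : A) : τ X = trd (π X) := by
  have htrp : ∀ X, trp π X = trd (π X) := fun _ => rfl
  have hd1 : (1 : ℝ) ≤ d := by exact_mod_cast K.hd
  have hD : 0 ≤ 1 - 1 / (d : ℝ) ^ 2 := by
    rw [sub_nonneg, div_le_one (by positivity)]; nlinarith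
  have hD1 : 1 - 1 / (d : ℝ) ^ 2 < 1 := by
    have : 0 < 1 / (d : ℝ) ^ 2 := by positivity
    linarith
  have hmk : ∀ l : ℝ, (∀ X, 0 ≤ ((τ - (l : ℂ) • trp π) (star X * X)).re) → PT (τ - (l : ℂ) • trp π) := by
    intro l hl
    refine ⟨fun X => ?_, hl, fun X Y => ?_⟩
    · simp [htrp, hτ.hstar, map_star, trd_star]
    · simp [htrp, hτ.tr X, trd_comm (π X)]
  have hk : ∀ k : ℕ, PT (τ - ((1 - (1 - 1 / (d : ℝ) ^ 2) ^ k : ℝ) : ℂ) • trp π) := by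
    intro k
    induction k with
    | zero => simpa using hτ
    | succ k ih =>
      apply hmk
      intro X
      have := domination K p hsa hpp hps hgen π hπ _ ih (fun v => by
        simp [htrp, h1, hm, hπ, trd_one K.hd, K.trd_eq]; ring) X
      set r := (1 - 1 / (d : ℝ) ^ 2) ^ k with hr
      simp only [LinearMap.sub_apply, LinearMap.smul_apply, smul_eq_mul, h1, htrp, map_one, trd_one K.hd,
        Complex.sub_re, Complex.re_ofReal_mul, map_mul, map_star, Complex.one_re, mul_one] at this ⊢
      rw [pow_succ, ← hr]
      have e : (1 - (1 - r)) / (d : ℝ) ^ 2 * (trd (star (π X) * π X)).re = r * (1 / (d : ℝ) ^ 2) * (trd (star (π X) * π X)).re := by ring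
      rw [Complex.ofReal_re, e] at this
      linarith
  have hlim : PT (τ - ((1 : ℝ) : ℂ) • trp π) := by
    apply hmk
    intro X
    have ht : Tendsto (fun k : ℕ => ((τ - ((1 - (1 - 1 / (d : ℝ) ^ 2) ^ k : ℝ) : ℂ) • trp π) (star X * X)).re) atTop
        (𝓝 (((τ - ((1 : ℝ) : ℂ) • trp π) (star X * X)).re)) := by
      simp only [LinearMap.sub_apply, LinearMap.smul_apply, smul_eq_mul, Complex.sub_re, Complex.re_ofReal_mul]
      have := tendsto_pow_atTop_nhds_zero_of_lt_one hD hD1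
      have h2 := (this.const_sub 1)
      rw [sub_zero] at h2
      exact (h2.mul_const _).const_sub _
    exact ge_of_tendsto' ht fun k => (hk k).pos X
  have h0 : nr (τ - ((1 : ℝ) : ℂ) • trp π) 1 = 0 := by
    simp [nr, htrp, h1, trd_one K.hd]
  have := nr_cs hlim 1 X
  rw [h0, zero_mul, star_one, one_mul] at this
  have := norm_le_zero_iff.1 this
  simp [htrp] at this
  exact sub_eq_zero.1 this

/-- star ring structure on a quotient by a star-closed two-sided ideal -/
def qHom (J : Ideal A) [J.IsTwoSided] (hJ : ∀ X ∈ J, star X ∈ J) : (A ⧸ J) →+* (A ⧸ J)ᵐᵒᵖ :=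
  Ideal.Quotient.lift J ((RingHom.op (Ideal.Quotient.mk J)).comp (starRingEquiv (R := A)).toRingHom)
    (fun X hX => by
      simp
      exact Ideal.Quotient.eq_zero_iff_mem.2 (hJ X hX))

@[reducible] def qStar (J : Ideal A) [J.IsTwoSided] (hJ : ∀ X ∈ J, star X ∈ J) : StarRing (A ⧸ J) where
  star q := (qHom J hJ q).unop
  star_involutive q := by
    obtain ⟨X, rfl⟩ := Ideal.Quotient.mk_surjective q
    change Ideal.Quotient.mk J (star (star X)) = _
    rw [star_star]
  star_mul q r := by rw [map_mul]; rfl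
  star_add q r := by rw [map_add]; rfl

lemma unique_mod (K : Canon n b d x Pt) 
    (p : Fin n → A) (hsa : ∀ v, star (p v) = p v) (hgen : Algebra.adjoin ℂ (Set.range p) = ⊤)
    (π : A →⋆ₐ[ℂ] Md d) (hπ : ∀ v, π (p v) = Pt v) (τ : A →ₗ[ℂ] ℂ) (hτ : PT τ) (h1 : τ 1 = 1)
    (hpp : ∀ v Y, τ ((p v * p v - p v) * Y) = 0)
    (hps : ∀ Y, τ ((∑ v, p v - (x : ℂ) • 1) * Y) = 0) 
    (hm : ∀ v, τ (p v) = tv Pt v) (X : A) : τ X = trd (π X) := by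
  let J : Ideal A := 
    { carrier := {X | (∀ Y, τ (X * Y) = 0) ∧ π X = 0}
      add_mem' := fun {X Y} hX hY => ⟨fun Z => by rw [add_mul, map_add, hX.1, hY.1, add_zero], by rw [map_add, hX.2, hY.2, add_zero]⟩
      zero_mem' := ⟨fun Y => by simp, by simp⟩
      smul_mem' := fun T X hX => ⟨fun Y => by rw [smul_eq_mul, mul_assoc, hτ.tr, mul_assoc, hX.1], by rw [smul_eq_mul, map_mul, hX.2, mul_zero]⟩ }
  have hJm : ∀ X, X ∈ J ↔ (∀ Y, τ (X * Y) = 0) ∧ π X = 0 := fun X => Iff.rfl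
  haveI : J.IsTwoSided := ⟨fun {X} T hX => by
    rw [hJm] at hX ⊢
    exact ⟨fun Y => by rw [mul_assoc, hX.1], by rw [map_mul, hX.2, zero_mul]⟩⟩
  have hJs : ∀ X ∈ J, star X ∈ J := by
    intro X hX
    rw [hJm] at hX ⊢
    refine ⟨fun Y => ?_, by rw [map_star, hX.2, star_zero]⟩
    rw [hτ.tr]
    have := hX.1 (star Y)
    have h2 := hτ.hstar (X * star Y)
    rw [this, map_zero, star_mul, star_star] at h2
    exact h2
  letI : StarRing (A ⧸ J) := qStar J hJs
  have hst : ∀ X : A, star (Ideal.Quotient.mk J X) = Ideal.Quotient.mk J (star X) := fun X => rfl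
  have hsm : ∀ (r : ℂ) (X : A), r • Ideal.Quotient.mk J X = Ideal.Quotient.mk J (r • X) := fun r X => rfl
  haveI : StarModule ℂ (A ⧸ J) := ⟨fun r q => by
    obtain ⟨X, rfl⟩ := Ideal.Quotient.mk_surjective q
    rw [hsm, hst, hst, star_smul, ← hsm]⟩
  have hsurj : Function.Surjective (Ideal.Quotient.mk J) := Ideal.Quotient.mk_surjective
  have hτJ : ∀ X Y, Ideal.Quotient.mk J X = Ideal.Quotient.mk J Y → τ X = τ Y := by
    intro X Y h
    have := (Ideal.Quotient.eq.1 h).1 1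
    rw [mul_one, map_sub, sub_eq_zero] at this
    exact this
  have hinv : ∀ X, τ (Function.surjInv hsurj (Ideal.Quotient.mk J X)) = τ X := fun X => hτJ _ _ (Function.surjInv_eq hsurj _)
  let τq : (A ⧸ J) →ₗ[ℂ] ℂ := 
    { toFun := fun q => τ (Function.surjInv hsurj q)
      map_add' := fun q r => by
        obtain ⟨X, rfl⟩ := hsurj q
        obtain ⟨Y, rfl⟩ := hsurj r
        rw [← map_add, hinv, hinv, hinv, map_add]
      map_smul' := fun r q => by
        obtain ⟨X, rfl⟩ := hsurj q
        rw [hsm, hinv, hinv, map_smul]; rfl }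
  have hτq : ∀ X, τq (Ideal.Quotient.mk J X) = τ X := hinv
  let πq : (A ⧸ J) →⋆ₐ[ℂ] Md d := 
    { Ideal.Quotient.liftₐ J π.toAlgHom (fun X hX => hX.2) with
      map_star' := fun q => by
        obtain ⟨X, rfl⟩ := hsurj q
        exact map_star π X }
  have hπq : ∀ X, πq (Ideal.Quotient.mk J X) = π X := fun X => rfl
  have hPT : PT τq := by
    refine ⟨fun q => ?_, fun q => ?_, fun q r => ?_⟩
    · obtain ⟨X, rfl⟩ := hsurj q
      rw [hst, hτq, hτq, hτ.hstar]
    · obtain ⟨X, rfl⟩ := hsurj q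
      rw [hst, ← map_mul, hτq]; exact hτ.pos X
    · obtain ⟨X, rfl⟩ := hsurj q
      obtain ⟨Y, rfl⟩ := hsurj r
      rw [← map_mul, ← map_mul, hτq, hτq, hτ.tr]
  have := unique_exact K (fun v => Ideal.Quotient.mk J (p v)) (fun v => by rw [hst, hsa]) (fun v => ?_) ?_ ?_ πq 
    (fun v => by rw [hπq, hπ]) τq hPT (by rw [← map_one (Ideal.Quotient.mk J), hτq, h1]) (fun v => by rw [hτq, hm]) (Ideal.Quotient.mk J X)
  · rwa [hτq, hπq] at this
  · rw [← map_mul]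
    refine Ideal.Quotient.eq.2 ⟨hpp v, ?_⟩
    rw [map_sub, map_mul, hπ, K.pp, sub_self]
  · rw [← map_sum, ← map_one (Ideal.Quotient.mk J), hsm]
    refine Ideal.Quotient.eq.2 ⟨hps, ?_⟩
    rw [map_sub, map_sum, map_smul, map_one]
    simp only [hπ]
    rw [K.hsum, sub_self]
  · have h := congrArg (Subalgebra.map (Ideal.Quotient.mkₐ ℂ J)) hgen
    rw [AlgHom.map_adjoin, Algebra.map_top, ← Set.range_comp] at h
    refine h.trans ?_
    rw [AlgHom.range_eq_top]
    exact hsurj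

end uniq

end part6

section part7
open Filter Topology

attribute [local instance] Matrix.frobeniusNormedAddCommGroup Matrix.frobeniusNormedSpace

section frob
variable {m k : Type*} [Fintype m] [Fintype k]

def ip (X Y : Matrix m k ℂ) : ℂ := (Xᴴ * Y).trace

lemma frob_sq (X : Matrix m k ℂ) : ‖X‖ ^ 2 = ∑ i, ∑ j, ‖X i j‖ ^ 2 := by
  rw [Matrix.frobenius_norm_def]
  simp only [Real.rpow_two]
  rw [← Real.rpow_natCast, ← Real.rpow_mul (by positivity)]
  norm_num

lemma ip_eq (X Y : Matrix m k ℂ) : ip X Y = ∑ i, ∑ j, (starRingEnd ℂ) (X i j) * Y i j := by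
  simp only [ip, Matrix.trace, Matrix.diag_apply, Matrix.mul_apply, Matrix.conjTranspose_apply]
  rw [Finset.sum_comm]; rfl

def vecE (X : Matrix m k ℂ) : EuclideanSpace ℂ (m × k) := WithLp.toLp 2 (fun q => X q.1 q.2)

lemma vecE_norm (X : Matrix m k ℂ) : ‖vecE X‖ = ‖X‖ := by
  rw [← abs_of_nonneg (norm_nonneg (vecE X)), ← abs_of_nonneg (norm_nonneg X), ← sq_eq_sq_iff_abs_eq_abs, frob_sq, EuclideanSpace.norm_sq_eq, Fintype.sum_prod_type]
  rfl

lemma ip_vec (X Y : Matrix m k ℂ) : ip X Y = inner ℂ (vecE X) (vecE Y) := by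
  rw [ip_eq]
  simp only [vecE, PiLp.inner_apply, RCLike.inner_apply, Fintype.sum_prod_type]
  refine Finset.sum_congr rfl fun i _ => Finset.sum_congr rfl fun j _ => mul_comm _ _

lemma ip_cs (X Y : Matrix m k ℂ) : ‖ip X Y‖ ≤ ‖X‖ * ‖Y‖ := by
  rw [ip_vec, ← vecE_norm, ← vecE_norm]; exact norm_inner_le_norm _ _

lemma ip_self (X : Matrix m k ℂ) : ip X X = ((‖X‖ ^ 2 : ℝ) : ℂ) := by
  rw [ip_vec, ← vecE_norm, inner_self_eq_norm_sq_to_K]; push_cast; rfl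

lemma ip_conj (X Y : Matrix m k ℂ) : (starRingEnd ℂ) (ip X Y) = ip Y X := by
  rw [ip_vec, ip_vec, inner_conj_symm]

lemma frob_star (X : Matrix m k ℂ) : ‖Xᴴ‖ = ‖X‖ := Matrix.frobenius_norm_conjTranspose X

end frob

section fam
variable {ι : Type} {dA dB : ι → ℕ} {A : Type*} [Ring A] [StarRing A] [Algebra ℂ A] [StarModule ℂ A]
  {n b d : ℕ} {x : ℝ} {Pt : Fin n → Md d}

/-- Family of approximate representations. -/
structure Fam (l : Filter ι) (x : ℝ) (Pt : Fin n → Md d) (Ψ : (s : ι) → Matrix (Fin (dA s)) (Fin (dB s)) ℂ)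
   (rA : (s : ι) → A →⋆ₐ[ℂ] Md (dA s)) (rB : (s : ι) → A →⋆ₐ[ℂ] Md (dB s)) (π : A →⋆ₐ[ℂ] Md d) (p : Fin n → A) : Prop where
  nrm : ∀ s, ‖Ψ s‖ = 1
  sa : ∀ v, star (p v) = p v
  gen : Algebra.adjoin ℂ (Set.range p) = ⊤
  hπ : ∀ v, π (p v) = Pt v
  ctA : ∀ s v (Y : Matrix (Fin (dA s)) (Fin (dB s)) ℂ), ‖rA s (p v) * Y‖ ≤ ‖Y‖
  ctB : ∀ s v (Y : Matrix (Fin (dA s)) (Fin (dB s)) ℂ), ‖Y * rB s (p v)‖ ≤ ‖Y‖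
  sy : ∀ v, Tendsto (fun s => ‖rA s (p v) * Ψ s - Ψ s * rB s (p v)‖) l (𝓝 0)
  pp : ∀ v, Tendsto (fun s => ‖rA s (p v * p v - p v) * Ψ s‖) l (𝓝 0)
  ss : Tendsto (fun s => ‖rA s (∑ v, p v - (x : ℂ) • 1) * Ψ s‖) l (𝓝 0)
  tt : ∀ v, Tendsto (fun s => ip (Ψ s) (rA s (p v) * Ψ s)) l (𝓝 (tv Pt v))

variable {l : Filter ι} {Ψ : (s : ι) → Matrix (Fin (dA s)) (Fin (dB s)) ℂ}
   {rA : (s : ι) → A →⋆ₐ[ℂ] Md (dA s)} {rB : (s : ι) → A →⋆ₐ[ℂ] Md (dB s)} {π : A →⋆ₐ[ℂ] Md d} {p : Fin n → A}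

lemma Fam.bd (f : Fam l x Pt Ψ rA rB π p) (X : A) : ∃ C : ℝ, 0 ≤ C ∧ ∀ s (Y : Matrix (Fin (dA s)) (Fin (dB s)) ℂ),
    ‖rA s X * Y‖ ≤ C * ‖Y‖ ∧ ‖Y * rB s X‖ ≤ C * ‖Y‖ := by
  have hX : X ∈ Algebra.adjoin ℂ (Set.range p) := by rw [f.gen]; trivial
  induction hX using Algebra.adjoin_induction with
  | mem X hX =>
    obtain ⟨v, rfl⟩ := hX
    exact ⟨1, zero_le_one, fun s Y => by rw [one_mul]; exact ⟨f.ctA s v Y, f.ctB s v Y⟩⟩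
  | algebraMap r =>
    refine ⟨‖r‖, norm_nonneg _, fun s Y => ?_⟩
    rw [Algebra.algebraMap_eq_smul_one, map_smul, map_smul, map_one, map_one]
    simp [norm_smul]
  | add X Y _ _ h1 h2 =>
    obtain ⟨C, hC, h1⟩ := h1
    obtain ⟨D, hD, h2⟩ := h2
    refine ⟨C + D, by positivity, fun s T => ?_⟩
    rw [map_add, map_add, Matrix.add_mul, Matrix.mul_add, add_mul]
    exact ⟨(norm_add_le _ _).trans (add_le_add (h1 s T).1 (h2 s T).1), (norm_add_le _ _).trans (add_le_add (h1 s T).2 (h2 s T).2)⟩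
  | mul X Y _ _ h1 h2 =>
    obtain ⟨C, hC, h1⟩ := h1
    obtain ⟨D, hD, h2⟩ := h2
    refine ⟨C * D, by positivity, fun s T => ⟨?_, ?_⟩⟩
    · rw [map_mul, Matrix.mul_assoc, mul_assoc]
      exact (h1 s _).1.trans (mul_le_mul_of_nonneg_left (h2 s T).1 hC)
    · rw [map_mul, ← Matrix.mul_assoc, mul_comm C, mul_assoc]
      exact (h2 s _).2.trans (mul_le_mul_of_nonneg_left (h1 s T).2 hD)

lemma Fam.limA (f : Fam l x Pt Ψ rA rB π p) (X : A) {Y : (s : ι) → Matrix (Fin (dA s)) (Fin (dB s)) ℂ}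
    (hY : Tendsto (fun s => ‖Y s‖) l (𝓝 0)) : Tendsto (fun s => ‖rA s X * Y s‖) l (𝓝 0) := by
  obtain ⟨C, hC, h⟩ := f.bd X
  have := hY.const_mul C
  rw [mul_zero] at this
  exact squeeze_zero (fun _ => norm_nonneg _) (fun s => (h s _).1) this

lemma Fam.limB (f : Fam l x Pt Ψ rA rB π p) (X : A) {Y : (s : ι) → Matrix (Fin (dA s)) (Fin (dB s)) ℂ}
    (hY : Tendsto (fun s => ‖Y s‖) l (𝓝 0)) : Tendsto (fun s => ‖Y s * rB s X‖) l (𝓝 0) := by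
  obtain ⟨C, hC, h⟩ := f.bd X
  have := hY.const_mul C
  rw [mul_zero] at this
  exact squeeze_zero (fun _ => norm_nonneg _) (fun s => (h s _).2) this

lemma lim_add {Y Z : (s : ι) → Matrix (Fin (dA s)) (Fin (dB s)) ℂ}
    (hY : Tendsto (fun s => ‖Y s‖) l (𝓝 0)) (hZ : Tendsto (fun s => ‖Z s‖) l (𝓝 0)) : 
    Tendsto (fun s => ‖Y s + Z s‖) l (𝓝 0) := by
  have := hY.add hZ
  rw [add_zero] at this
  exact squeeze_zero (fun _ => norm_nonneg _) (fun s => norm_add_le _ _) this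

lemma Fam.syn (f : Fam l x Pt Ψ rA rB π p) (X : A) : Tendsto (fun s => ‖rA s X * Ψ s - Ψ s * rB s X‖) l (𝓝 0) := by
  have hX : X ∈ Algebra.adjoin ℂ (Set.range p) := by rw [f.gen]; trivial
  induction hX using Algebra.adjoin_induction with
  | mem X hX =>
    obtain ⟨v, rfl⟩ := hX
    exact f.sy v
  | algebraMap r =>
    simp only [Algebra.algebraMap_eq_smul_one, map_smul, map_one]
    simp
    exact tendsto_const_nhds
  | add X Y _ _ h1 h2 =>
    refine (lim_add h1 h2).congr fun s => ?_
    congr 1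
    rw [map_add, map_add, Matrix.add_mul, Matrix.mul_add]; abel
  | mul X Y _ _ h1 h2 =>
    refine (lim_add (f.limA X h2) (f.limB Y h1)).congr fun s => ?_
    congr 1
    rw [map_mul, map_mul, Matrix.mul_sub, Matrix.sub_mul]
    simp only [Matrix.mul_assoc]; abel

def gX (Ψ : (s : ι) → Matrix (Fin (dA s)) (Fin (dB s)) ℂ) (rA : (s : ι) → A →⋆ₐ[ℂ] Md (dA s)) (X : A) (s : ι) : ℂ :=
  ip (Ψ s) (rA s X * Ψ s)

lemma gX_mul (X Y : A) (s : ι) : gX Ψ rA (X * Y) s = ip (rA s (star X) * Ψ s) (rA s Y * Ψ s) := by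
  rw [gX, ip, ip, Matrix.conjTranspose_mul, map_star, map_mul, Matrix.star_eq_conjTranspose, Matrix.conjTranspose_conjTranspose]
  simp only [Matrix.mul_assoc]

lemma Fam.gb (f : Fam l x Pt Ψ rA rB π p) (X : A) : ∃ C : ℝ, 0 ≤ C ∧ ∀ s, ‖gX Ψ rA X s‖ ≤ C := by
  obtain ⟨C, hC, h⟩ := f.bd X
  refine ⟨C, hC, fun s => ?_⟩
  have h1 := ip_cs (Ψ s) (rA s X * Ψ s)
  have h2 := (h s (Ψ s)).1
  rw [f.nrm, mul_one] at h2
  rw [f.nrm, one_mul] at h1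
  exact h1.trans h2

lemma Fam.nb (f : Fam l x Pt Ψ rA rB π p) (X : A) : ∃ C : ℝ, 0 ≤ C ∧ ∀ s, ‖rA s X * Ψ s‖ ≤ C := by
  obtain ⟨C, hC, h⟩ := f.bd X
  refine ⟨C, hC, fun s => ?_⟩
  have h2 := (h s (Ψ s)).1
  rwa [f.nrm, mul_one] at h2

lemma Fam.g_tr (f : Fam l x Pt Ψ rA rB π p) (X Y : A) : Tendsto (fun s => gX Ψ rA (X * Y) s - gX Ψ rA (Y * X) s) l (𝓝 0) := by
  obtain ⟨C, hC, h1⟩ := f.nb (star X)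
  obtain ⟨D, hD, h2⟩ := f.nb X
  have h3 := ((f.syn Y).const_mul C).add ((f.syn (star Y)).mul_const D)
  rw [mul_zero, zero_mul, add_zero] at h3
  refine squeeze_zero_norm (fun s => ?_) h3
  have e : gX Ψ rA (X * Y) s - gX Ψ rA (Y * X) s = ip (rA s (star X) * Ψ s) (rA s Y * Ψ s - Ψ s * rB s Y)
      - ip (rA s (star Y) * Ψ s - Ψ s * rB s (star Y)) (rA s X * Ψ s) := by
    rw [gX_mul, gX_mul]
    have : ip (rA s (star X) * Ψ s) (Ψ s * rB s Y) = ip (Ψ s * rB s (star Y)) (rA s X * Ψ s) := by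
      simp only [ip, Matrix.conjTranspose_mul, map_star, Matrix.star_eq_conjTranspose, Matrix.conjTranspose_conjTranspose]
      rw [← Matrix.mul_assoc, Matrix.trace_mul_comm]
      simp only [Matrix.mul_assoc]
    have e1 : ∀ (U V W : Matrix (Fin (dA s)) (Fin (dB s)) ℂ), ip U (V - W) = ip U V - ip U W := by
      intro U V W; simp [ip, Matrix.mul_sub]
    have e2 : ∀ (U V W : Matrix (Fin (dA s)) (Fin (dB s)) ℂ), ip (U - V) W = ip U W - ip V W := by
      intro U V W; simp [ip, Matrix.sub_mul]
    rw [e1, e2, this]; ring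
  rw [e]
  refine (norm_sub_le _ _).trans (add_le_add ?_ ?_)
  · exact (ip_cs _ _).trans (mul_le_mul_of_nonneg_right (h1 s) (norm_nonneg _))
  · exact (ip_cs _ _).trans (mul_le_mul_of_nonneg_left (h2 s) (norm_nonneg _))

lemma Fam.g_zero (f : Fam l x Pt Ψ rA rB π p) (X Y : A) (hX : star X = X) (h : Tendsto (fun s => ‖rA s X * Ψ s‖) l (𝓝 0)) :
    Tendsto (fun s => gX Ψ rA (X * Y) s) l (𝓝 0) := by
  obtain ⟨D, hD, h2⟩ := f.nb Y
  have h3 := h.mul_const D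
  rw [zero_mul] at h3
  refine squeeze_zero_norm (fun s => ?_) h3
  rw [gX_mul, hX]
  exact (ip_cs _ _).trans (mul_le_mul_of_nonneg_left (h2 s) (norm_nonneg _))

lemma Fam.lim (K : Canon n b d x Pt) (f : Fam l x Pt Ψ rA rB π p) (X : A) : Tendsto (fun s => gX Ψ rA X s) l (𝓝 (trd (π X))) := by
  rw [tendsto_iff_ultrafilter]
  intro ω hω
  have hω' : (ω : Filter ι) ≤ l := hω
  have ex : ∀ X, ∃ a, Tendsto (gX Ψ rA X) ω (𝓝 a) := by
    intro X
    obtain ⟨C, hC, h⟩ := f.gb X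
    obtain ⟨a, _, ha⟩ := (isCompact_closedBall (0 : ℂ) C).ultrafilter_le_nhds (ω.map (gX Ψ rA X)) (by
      rw [le_principal_iff]
      refine Filter.Eventually.of_forall (f := (ω : Filter ι)) fun s => ?_
      change gX Ψ rA X s ∈ Metric.closedBall 0 C
      rw [mem_closedBall_zero_iff]; exact h s)
    exact ⟨a, ha⟩
  choose t ht using ex
  have huniq : ∀ X a, Tendsto (gX Ψ rA X) ω (𝓝 a) → t X = a := fun X a h => tendsto_nhds_unique (ht X) h
  let τ : A →ₗ[ℂ] ℂ := 
    { toFun := t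
      map_add' := fun X Y => huniq _ _ (((ht X).add (ht Y)).congr fun s => by
        simp only [gX, ip, map_add, Matrix.add_mul, Matrix.mul_add, Matrix.trace_add])
      map_smul' := fun r X => huniq _ _ (((ht X).const_mul r).congr fun s => by
        simp only [gX, ip, map_smul, Matrix.smul_mul, Matrix.mul_smul, Matrix.trace_smul, smul_eq_mul]) }
  have hτ : ∀ X, τ X = t X := fun _ => rfl
  have hPT : PT τ := by
    refine ⟨fun X => ?_, fun X => ?_, fun X Y => ?_⟩
    · refine huniq _ _ (((Complex.continuous_conj.tendsto _).comp (ht X)).congr fun s => ?_)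
      simp only [Function.comp, gX, ip_conj]
      rw [ip, ip, Matrix.conjTranspose_mul, map_star, Matrix.star_eq_conjTranspose, Matrix.mul_assoc]
    · rw [hτ]
      refine ge_of_tendsto' ((Complex.continuous_re.tendsto _).comp (ht (star X * X))) fun s => ?_
      simp only [Function.comp]
      rw [gX_mul, star_star, ip_self, Complex.ofReal_re]
      positivity
    · have h1 := (ht (X * Y)).sub (ht (Y * X))
      have h2 := (f.g_tr X Y).mono_left hω'
      exact sub_eq_zero.1 (tendsto_nhds_unique h1 h2)
  have := unique_mod K p f.sa f.gen π f.hπ τ hPT (huniq _ _ (tendsto_const_nhds.congr fun s => ?_)) 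
    (fun v Y => huniq _ _ ?_) (fun Y => huniq _ _ ?_) (fun v => huniq _ _ ((f.tt v).mono_left hω')) X
  · rw [← this]; exact ht X
  · rw [gX, map_one, Matrix.one_mul, ip_self, f.nrm]; simp
  · exact (f.g_zero _ Y (by simp [f.sa]) (f.pp v)).mono_left hω'
  · refine (f.g_zero _ Y ?_ f.ss).mono_left hω'
    rw [star_sub, star_sum, star_smul, star_one]
    simp [f.sa]

lemma Fam.ker (K : Canon n b d x Pt) (f : Fam l x Pt Ψ rA rB π p) (X : A) (hX : π X = 0) :
    Tendsto (fun s => ‖rA s X * Ψ s‖) l (𝓝 0) := by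
  have h := f.lim K (star X * X)
  rw [map_mul, hX, mul_zero] at h
  have h2 := ((Complex.continuous_re.tendsto _).comp h).sqrt
  rw [show (trd (0 : Md d)).re = 0 by simp [trd], Real.sqrt_zero] at h2
  refine h2.congr fun s => ?_
  simp only [Function.comp]
  rw [gX_mul, star_star, ip_self, Complex.ofReal_re, Real.sqrt_sq (norm_nonneg _)]

lemma Fam.kerB (K : Canon n b d x Pt) (f : Fam l x Pt Ψ rA rB π p) (X : A) (hX : π X = 0) :
    Tendsto (fun s => ‖Ψ s * rB s X‖) l (𝓝 0) := by
  have h1 := f.ker K X hX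
  have h2 := f.syn X
  have h3 := h1.add h2
  rw [add_zero] at h3
  refine squeeze_zero (fun _ => norm_nonneg _) (fun s => ?_) h3
  have : Ψ s * rB s X = rA s X * Ψ s - (rA s X * Ψ s - Ψ s * rB s X) := by abel
  calc ‖Ψ s * rB s X‖ = ‖rA s X * Ψ s - (rA s X * Ψ s - Ψ s * rB s X)‖ := by rw [← this]
    _ ≤ _ := norm_sub_le _ _

end fam

end part7

section part8
open Filter Topology

attribute [local instance] Matrix.frobeniusNormedAddCommGroup Matrix.frobeniusNormedSpace

section blocks
variable {d m : ℕ}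

abbrev BI (d m : ℕ) := Fin d × (Fin m ⊕ Fin m)

def blk (X X' : Fin d → Md m) : Matrix (BI d m) (Fin m) ℂ :=
  Matrix.of fun y c => Sum.elim (fun a => X y.1 a c) (fun a => X' y.1 a c) y.2

lemma blk_mul (X X' Z Z' : Fin d → Md m) : (blk X X')ᴴ * blk Z Z' = ∑ i, ((X i)ᴴ * Z i + (X' i)ᴴ * Z' i) := by
  ext a c
  simp only [Matrix.mul_apply, Matrix.conjTranspose_apply, Matrix.sum_apply, Matrix.add_apply, Fintype.sum_prod_type, Fintype.sum_sum_type, blk, Matrix.of_apply, Sum.elim_inl, Sum.elim_inr]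

def TT (V : Fin d → Md m) : Md m := ∑ i, (V i)ᴴ * V i
def RR (V : Fin d → Md m) : Md m := (1 + TT V)⁻¹
def W0 (V : Fin d → Md m) : Matrix (BI d m) (Fin m) ℂ := blk V (fun _ => 0)
def GG (i0 : Fin d) (V : Fin d → Md m) : Matrix (BI d m) (Fin m) ℂ := 
  blk (fun i => V i * RR V) (fun i => if i = i0 then RR V else 0)
def WW (i0 : Fin d) (V : Fin d → Md m) : Matrix (BI d m) (Fin m) ℂ := W0 V + GG i0 V * (1 - TT V)

lemma TT_psd (V : Fin d → Md m) : (TT V).PosSemidef :=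
  Matrix.posSemidef_sum _ fun i _ => Matrix.posSemidef_conjTranspose_mul_self _

lemma unit1T (V : Fin d → Md m) : IsUnit (1 + TT V).det := by
  have : (1 + TT V).PosDef := Matrix.PosDef.one.add_posSemidef (TT_psd V)
  exact (Matrix.isUnit_iff_isUnit_det _).1 this.isUnit

lemma R1 (V : Fin d → Md m) : RR V * TT V = 1 - RR V := by
  have := Matrix.nonsing_inv_mul _ (unit1T V)
  rw [mul_add, mul_one] at this
  exact eq_sub_of_add_eq' this

lemma R2 (V : Fin d → Md m) : TT V * RR V = 1 - RR V := by
  have := Matrix.mul_nonsing_inv _ (unit1T V)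
  rw [add_mul, one_mul] at this
  exact eq_sub_of_add_eq' this

lemma TTs (V : Fin d → Md m) : (TT V)ᴴ = TT V := (TT_psd V).1
lemma RRs (V : Fin d → Md m) : (RR V)ᴴ = RR V := by
  rw [RR, Matrix.conjTranspose_nonsing_inv, Matrix.conjTranspose_add, TTs, Matrix.conjTranspose_one]

lemma GW (i0 : Fin d) (V : Fin d → Md m) : (GG i0 V)ᴴ * W0 V = 1 - RR V := by
  rw [GG, W0, blk_mul]
  simp only [Matrix.conjTranspose_mul, RRs, mul_zero, add_zero, Matrix.mul_assoc]
  rw [← Finset.mul_sum]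
  exact R1 V

lemma WG (i0 : Fin d) (V : Fin d → Md m) : (W0 V)ᴴ * GG i0 V = 1 - RR V := by
  have := congrArg Matrix.conjTranspose (GW i0 V)
  rw [Matrix.conjTranspose_mul, Matrix.conjTranspose_conjTranspose, Matrix.conjTranspose_sub, RRs, Matrix.conjTranspose_one] at this
  exact this

lemma W0W0 (V : Fin d → Md m) : (W0 V)ᴴ * W0 V = TT V := by
  rw [W0, blk_mul]; simp [TT]

lemma GGG (i0 : Fin d) (V : Fin d → Md m) : (GG i0 V)ᴴ * GG i0 V = RR V := by
  rw [GG, blk_mul, Finset.sum_add_distrib]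
  have h1 : ∀ i, (V i * RR V)ᴴ * (V i * RR V) = RR V * ((V i)ᴴ * V i) * RR V := by
    intro i; rw [Matrix.conjTranspose_mul, RRs]; simp only [Matrix.mul_assoc]
  have h2 : ∀ i, (if i = i0 then RR V else 0)ᴴ * (if i = i0 then RR V else 0) = if i = i0 then RR V * RR V else 0 := by
    intro i; split_ifs
    · rw [RRs]
    · simp
  simp only [h1, h2]
  rw [← Finset.sum_mul, ← Finset.mul_sum, Finset.sum_ite_eq' Finset.univ i0]
  simp only [Finset.mem_univ, if_true]
  change RR V * TT V * RR V + _ = _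
  rw [R1]; noncomm_ring

lemma WWiso (i0 : Fin d) (V : Fin d → Md m) : (WW i0 V)ᴴ * WW i0 V = 1 := by
  have e : (WW i0 V)ᴴ = (W0 V)ᴴ + (1 - TT V) * (GG i0 V)ᴴ := by
    rw [WW, Matrix.conjTranspose_add, Matrix.conjTranspose_mul, Matrix.conjTranspose_sub, TTs, Matrix.conjTranspose_one]
  have h1 : (WW i0 V)ᴴ * WW i0 V = TT V + (1 - RR V) * (1 - TT V) + (1 - TT V) * (1 - RR V) + (1 - TT V) * RR V * (1 - TT V) := by
    rw [e, WW, Matrix.add_mul, Matrix.mul_add, Matrix.mul_add, W0W0, ← Matrix.mul_assoc, WG, Matrix.mul_assoc, GW,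
      ← Matrix.mul_assoc, Matrix.mul_assoc (1 - TT V) _ (GG i0 V), GGG]
    abel
  rw [h1]
  have h2 : (1 - TT V) * RR V = RR V + RR V - 1 := by rw [sub_mul, R2]; noncomm_ring
  rw [h2]
  simp only [mul_sub, sub_mul, add_mul, R1, R2, one_mul, mul_one]
  abel

variable {k : Type*} [Fintype k]

lemma re_ip (Y : Matrix (Fin m) k ℂ) : (ip Y Y).re = ‖Y‖ ^ 2 := by rw [ip_self, Complex.ofReal_re]

lemma iso_norm {q : Type*} [Fintype q] (W : Matrix q (Fin m) ℂ) (hW : Wᴴ * W = 1) (Y : Matrix (Fin m) k ℂ) : ‖W * Y‖ = ‖Y‖ := by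
  have h : ip (W * Y) (W * Y) = ip Y Y := by
    rw [ip, ip, Matrix.conjTranspose_mul, Matrix.mul_assoc, ← Matrix.mul_assoc Wᴴ, hW, Matrix.one_mul]
  rw [ip_self, ip_self] at h
  have h2 : ‖W * Y‖ ^ 2 = ‖Y‖ ^ 2 := by exact_mod_cast h
  exact (sq_eq_sq₀ (norm_nonneg _) (norm_nonneg _)).1 h2

lemma RR_contr (V : Fin d → Md m) (Y : Matrix (Fin m) k ℂ) : ‖RR V * Y‖ ≤ ‖Y‖ := by
  set Z := RR V * Y with hZ
  have hY : Y = Z + TT V * Z := by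
    rw [hZ, ← Matrix.mul_assoc, R2, ← Matrix.add_mul]
    rw [add_sub_cancel, Matrix.one_mul]
  have h1 : ip Z Y = ip Z Z + ∑ i, ip (V i * Z) (V i * Z) := by
    simp only [ip]
    conv_lhs => rw [hY]
    rw [Matrix.mul_add, Matrix.trace_add, ← Matrix.trace_sum]
    congr 2
    simp only [TT, Matrix.conjTranspose_mul, Matrix.sum_mul, Matrix.mul_sum, Matrix.mul_assoc]
  have h2 : ‖Z‖ ^ 2 ≤ (ip Z Y).re := by
    rw [h1, Complex.add_re, re_ip, Complex.re_sum]
    have : 0 ≤ ∑ i, (ip (V i * Z) (V i * Z)).re := Finset.sum_nonneg fun i _ => by rw [re_ip]; positivity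
    linarith
  have h3 : ‖Z‖ ^ 2 ≤ ‖Z‖ * ‖Y‖ := h2.trans ((Complex.re_le_norm _).trans (ip_cs _ _))
  rcases (norm_nonneg Z).eq_or_lt with h | h
  · rw [← h]; exact norm_nonneg _
  · rw [pow_two] at h3; exact le_of_mul_le_mul_left h3 h

lemma GG_contr (i0 : Fin d) (V : Fin d → Md m) (Y : Matrix (Fin m) k ℂ) : ‖GG i0 V * Y‖ ≤ ‖Y‖ := by
  have h : ip (GG i0 V * Y) (GG i0 V * Y) = ip Y (RR V * Y) := by
    rw [ip, ip, Matrix.conjTranspose_mul, Matrix.mul_assoc, ← Matrix.mul_assoc (GG i0 V)ᴴ, GGG]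
  have h2 : ‖GG i0 V * Y‖ ^ 2 ≤ ‖Y‖ ^ 2 := by
    have : ‖GG i0 V * Y‖ ^ 2 = (ip Y (RR V * Y)).re := by rw [← h, ip_self, Complex.ofReal_re]
    rw [this]
    refine (Complex.re_le_norm _).trans ((ip_cs _ _).trans ?_)
    rw [pow_two]
    exact mul_le_mul_of_nonneg_left (RR_contr V Y) (norm_nonneg _)
  exact (sq_le_sq₀ (norm_nonneg _) (norm_nonneg _)).1 h2

lemma GG_contr' (i0 : Fin d) (V : Fin d → Md m) (Y : Matrix k (Fin m) ℂ) : ‖Y * (GG i0 V)ᴴ‖ ≤ ‖Y‖ := by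
  have := GG_contr i0 V Yᴴ
  rw [frob_star] at this
  rwa [← frob_star, Matrix.conjTranspose_mul, Matrix.conjTranspose_conjTranspose]

lemma WW_norm' (i0 : Fin d) (V : Fin d → Md m) (Y : Matrix k (Fin m) ℂ) : ‖Y * (WW i0 V)ᴴ‖ = ‖Y‖ := by
  rw [← frob_star, Matrix.conjTranspose_mul, Matrix.conjTranspose_conjTranspose, iso_norm _ (WWiso i0 V), frob_star]

lemma W0_bound (i0 : Fin d) (V : Fin d → Md m) (Y : Matrix (Fin m) k ℂ) : ‖W0 V * Y‖ ≤ ‖Y‖ + ‖(1 - TT V) * Y‖ := by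
  have : W0 V * Y = WW i0 V * Y - GG i0 V * ((1 - TT V) * Y) := by
    rw [WW, Matrix.add_mul, Matrix.mul_assoc, add_sub_cancel_right]
  rw [this]
  refine (norm_sub_le _ _).trans (add_le_add ?_ ?_)
  · rw [iso_norm _ (WWiso i0 V)]
  · exact GG_contr _ _ _

/-- Replacing the isometries by the block columns. -/
lemma WW_diff {m' : ℕ} (i0 : Fin d) (V : Fin d → Md m) (U : Fin d → Md m') (Y : Matrix (Fin m) (Fin m') ℂ) :
    ‖WW i0 V * Y * (WW i0 U)ᴴ - W0 V * Y * (W0 U)ᴴ‖ ≤ 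
      ‖(1 - TT V) * Y‖ + (‖Y * (1 - TT U)‖ + ‖(1 - TT V) * (Y * (1 - TT U))‖) := by
  have e : WW i0 V * Y * (WW i0 U)ᴴ - W0 V * Y * (W0 U)ᴴ = 
      GG i0 V * ((1 - TT V) * Y) * (WW i0 U)ᴴ + W0 V * (Y * (1 - TT U)) * (GG i0 U)ᴴ := by
    have h1 : (WW i0 U)ᴴ - (W0 U)ᴴ = (1 - TT U) * (GG i0 U)ᴴ := by
      rw [WW, Matrix.conjTranspose_add, Matrix.conjTranspose_mul, Matrix.conjTranspose_sub, TTs, Matrix.conjTranspose_one, add_sub_cancel_left]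
    have h2 : GG i0 V * ((1 - TT V) * Y) = WW i0 V * Y - W0 V * Y := by
      rw [WW, Matrix.add_mul, Matrix.mul_assoc, add_sub_cancel_left]
    have h3 : W0 V * (Y * (1 - TT U)) * (GG i0 U)ᴴ = W0 V * Y * ((1 - TT U) * (GG i0 U)ᴴ) := by
      simp only [Matrix.mul_assoc]
    rw [h2, h3, ← h1, Matrix.sub_mul, Matrix.mul_sub]; abel
  rw [e]
  refine (norm_add_le _ _).trans (add_le_add ?_ ?_)
  · rw [WW_norm']; exact GG_contr _ _ _
  · exact (GG_contr' _ _ _).trans (W0_bound i0 _ _)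

/-- target matrices -/
def tgt {m' : ℕ} (c : Md d) (X : Matrix (Fin m) (Fin m') ℂ) : Matrix (BI d m) (BI d m') ℂ :=
  Matrix.of fun y z => c y.1 z.1 * Sum.elim (fun a => Sum.elim (fun a' => X a a') (fun _ => 0) z.2) (fun _ => 0) y.2

lemma W0_tgt_sq {m' : ℕ} (V : Fin d → Md m) (U : Fin d → Md m') (Y X : Matrix (Fin m) (Fin m') ℂ) (c : Md d) :
    ‖W0 V * Y * (W0 U)ᴴ - tgt c X‖ ^ 2 = ∑ i, ∑ j, ‖V i * Y * (U j)ᴴ - c i j • X‖ ^ 2 := by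
  have hb : ∀ i j a a', (W0 V * Y * (W0 U)ᴴ) (i, Sum.inl a) (j, Sum.inl a') = (V i * Y * (U j)ᴴ) a a' := by
    intro i j a a'
    simp [Matrix.mul_apply, W0, blk]
  have h1 : ∀ i a z, (W0 V * Y * (W0 U)ᴴ) (i, Sum.inr a) z = 0 := by
    intro i a z; simp [Matrix.mul_apply, W0, blk]
  have h2 : ∀ y j a, (W0 V * Y * (W0 U)ᴴ) y (j, Sum.inr a) = 0 := by
    intro i a z; simp [Matrix.mul_apply, W0, blk]
  rw [frob_sq]
  simp only [frob_sq, Fintype.sum_prod_type, Fintype.sum_sum_type, Matrix.sub_apply, hb, h1, h2, tgt, Matrix.of_apply, Sum.elim_inl, Sum.elim_inr, mul_zero, sub_zero, norm_zero, Matrix.smul_apply, smul_eq_mul]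
  simp only [ne_eq, OfNat.ofNat_ne_zero, not_false_eq_true, zero_pow, Finset.sum_const_zero, add_zero]
  refine Finset.sum_congr rfl fun i _ => ?_
  rw [Finset.sum_comm]

lemma tgt_smul_norm {m' : ℕ} (c : Md d) (X X' : Matrix (Fin m) (Fin m') ℂ) : ‖tgt c X - tgt c X'‖ = ‖c‖ * ‖X - X'‖ := by
  have : ‖tgt c X - tgt c X'‖ ^ 2 = (‖c‖ * ‖X - X'‖) ^ 2 := by
    rw [mul_pow, frob_sq, frob_sq, frob_sq]
    simp only [Fintype.sum_prod_type, Fintype.sum_sum_type, Matrix.sub_apply, tgt, Matrix.of_apply, Sum.elim_inl, Sum.elim_inr, mul_zero, sub_zero, norm_zero, ← mul_sub, norm_mul, mul_pow]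
    simp only [ne_eq, OfNat.ofNat_ne_zero, not_false_eq_true, zero_pow, mul_zero, Finset.sum_const_zero, add_zero]
    simp only [Finset.sum_mul]
    refine Finset.sum_congr rfl fun i _ => ?_
    rw [Finset.sum_comm]
    refine Finset.sum_congr rfl fun j _ => ?_
    simp only [Finset.mul_sum]
  exact (sq_eq_sq₀ (norm_nonneg _) (by positivity)).1 this

end blocks

end part8

section part9
open Filter Topology

attribute [local instance] Matrix.frobeniusNormedAddCommGroup Matrix.frobeniusNormedSpace

section dil
variable {ι : Type} {dA dB : ι → ℕ} {A : Type*} [Ring A] [StarRing A] [Algebra ℂ A] [StarModule ℂ A]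
  {n b d : ℕ} {x : ℝ} {Pt : Fin n → Md d}
variable {l : Filter ι} {Ψ : (s : ι) → Matrix (Fin (dA s)) (Fin (dB s)) ℂ}
   {rA : (s : ι) → A →⋆ₐ[ℂ] Md (dA s)} {rB : (s : ι) → A →⋆ₐ[ℂ] Md (dB s)} {π : A →⋆ₐ[ℂ] Md d} {p : Fin n → A}

lemma Fam.mid (f : Fam l x Pt Ψ rA rB π p) (X Y : A) : 
    Tendsto (fun s => ‖rA s X * Ψ s * rB s Y - rA s (X * Y) * Ψ s‖) l (𝓝 0) := by
  refine (f.limA X (f.syn Y)).congr fun s => ?_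
  rw [← norm_neg]
  congr 1
  rw [map_mul, Matrix.mul_sub]
  simp only [Matrix.mul_assoc]; abel

lemma Fam.midz (K : Canon n b d x Pt) (f : Fam l x Pt Ψ rA rB π p) (X Y Z : A) (h : π (X * Y) = π Z) : 
    Tendsto (fun s => ‖rA s X * Ψ s * rB s Y - rA s Z * Ψ s‖) l (𝓝 0) := by
  refine (lim_add (f.mid X Y) (f.ker K (X * Y - Z) (by rw [map_sub, h, sub_self]))).congr fun s => ?_
  congr 1
  rw [map_sub, Matrix.sub_mul]; abel

lemma Fam.midz0 (K : Canon n b d x Pt) (f : Fam l x Pt Ψ rA rB π p) (X Y : A) (h : π (X * Y) = 0) : 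
    Tendsto (fun s => ‖rA s X * Ψ s * rB s Y‖) l (𝓝 0) := by
  refine (f.midz K X Y 0 (by rw [h, map_zero])).congr fun s => ?_
  rw [map_zero, Matrix.zero_mul, sub_zero]

lemma Fam.dil (K : Canon n b d x Pt) (f : Fam l x Pt Ψ rA rB π p) :
    ∃ (WA : (s : ι) → Matrix (BI d (dA s)) (Fin (dA s)) ℂ) (WB : (s : ι) → Matrix (BI d (dB s)) (Fin (dB s)) ℂ)
      (χ : (s : ι) → Matrix (Fin (dA s)) (Fin (dB s)) ℂ),
      (∀ s, (WA s)ᴴ * WA s = 1) ∧ (∀ s, (WB s)ᴴ * WB s = 1) ∧ (∀ s, ‖χ s‖ = 1) ∧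
      ∀ Y1 Y2 : A, Tendsto (fun s => ‖WA s * (rA s Y1 * Ψ s * rB s Y2) * (WB s)ᴴ - 
        tgt ((((Real.sqrt d)⁻¹ : ℝ) : ℂ) • (π Y1 * π Y2)) (χ s)‖) l (𝓝 0) := by
  set i0 : Fin d := ⟨0, K.hd⟩ with hi0
  have hex : ∀ i, ∃ X, π X = Matrix.single i0 i (1 : ℂ) := fun i => K.surj π p f.hπ _
  choose g hg using hex
  set t : A := ∑ i, star (g i) * g i with ht
  have hπt : π t = 1 := by
    rw [ht, map_sum]
    simp only [map_mul, map_star, hg, Matrix.star_eq_conjTranspose, Matrix.conjTranspose_single, star_one, Matrix.single_mul_single_same, mul_one]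
    exact Matrix.sum_single_one
  have htA : ∀ s, TT (fun i => rA s (g i)) = rA s t := by
    intro s; rw [ht, map_sum]; simp only [TT, map_mul, map_star, Matrix.star_eq_conjTranspose]
  have htB : ∀ s, TT (fun i => rB s (g i)) = rB s t := by
    intro s; rw [ht, map_sum]; simp only [TT, map_mul, map_star, Matrix.star_eq_conjTranspose]
  have hd0 : (0 : ℝ) < d := by exact_mod_cast K.hd
  have hsd : Real.sqrt d ≠ 0 := (Real.sqrt_pos.2 hd0).ne'
  let χ' : (s : ι) → Matrix (Fin (dA s)) (Fin (dB s)) ℂ := fun s => ((Real.sqrt d : ℝ) : ℂ) • (rA s (g i0) * Ψ s)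
  have hχ' : Tendsto (fun s => ‖χ' s‖) l (𝓝 1) := by
    have h1 := f.lim K (star (g i0) * g i0)
    have h2 := (((Complex.continuous_re.tendsto _).comp h1).const_mul (d : ℝ)).sqrt
    have h3 : (d : ℝ) * (trd (π (star (g i0) * g i0))).re = 1 := by
      rw [map_mul, map_star, hg, Matrix.star_eq_conjTranspose, Matrix.conjTranspose_single, star_one, Matrix.single_mul_single_same, mul_one, trd, Matrix.trace_single_eq_same]
      have : (1 : ℂ) / (d : ℂ) = ((1 / d : ℝ) : ℂ) := by push_cast; rfl
      rw [this, Complex.ofReal_re]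
      field_simp
    rw [h3, Real.sqrt_one] at h2
    refine h2.congr fun s => ?_
    simp only [Function.comp]
    rw [gX_mul, star_star, ip_self, Complex.ofReal_re, Real.sqrt_mul hd0.le, Real.sqrt_sq (norm_nonneg _), norm_smul,
      Complex.norm_real, Real.norm_of_nonneg (Real.sqrt_nonneg _)]
  classical
  let χ : (s : ι) → Matrix (Fin (dA s)) (Fin (dB s)) ℂ := fun s => if χ' s = 0 then Ψ s else ((‖χ' s‖⁻¹ : ℝ) : ℂ) • χ' s
  have hχ1 : ∀ s, ‖χ s‖ = 1 := by
    intro s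
    simp only [χ]
    split_ifs with h
    · exact f.nrm s
    · rw [norm_smul, Complex.norm_real, norm_inv, norm_norm, inv_mul_cancel₀ (norm_ne_zero_iff.2 h)]
  have hχd : ∀ s, ‖χ' s - χ s‖ = |‖χ' s‖ - 1| := by
    intro s
    simp only [χ]
    split_ifs with h
    · rw [h, zero_sub, norm_neg, f.nrm, norm_zero]; simp
    · have h0 := norm_ne_zero_iff.2 h
      have : χ' s - ((‖χ' s‖⁻¹ : ℝ) : ℂ) • χ' s = ((1 - ‖χ' s‖⁻¹ : ℝ) : ℂ) • χ' s := by
        push_cast; rw [sub_smul, one_smul]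
      rw [this, norm_smul, Complex.norm_real, Real.norm_eq_abs]
      have h4 : ∀ r : ℝ, 0 ≤ r → r ≠ 0 → |1 - r⁻¹| * r = |r - 1| := by
        intro r hr hr0
        have : |1 - r⁻¹| * |r| = |r - 1| := by rw [← abs_mul, sub_mul, one_mul, inv_mul_cancel₀ hr0]
        rwa [abs_of_nonneg hr] at this
      exact h4 _ (norm_nonneg _) h0
  refine ⟨fun s => WW i0 (fun i => rA s (g i)), fun s => WW i0 (fun i => rB s (g i)), χ, fun s => WWiso _ _, fun s => WWiso _ _, hχ1, fun Y1 Y2 => ?_⟩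
  set c : Md d := (((Real.sqrt d)⁻¹ : ℝ) : ℂ) • (π Y1 * π Y2) with hc
  -- first difference
  have D1 : Tendsto (fun s => ‖(1 - TT (fun i => rA s (g i))) * (rA s Y1 * Ψ s * rB s Y2)‖ + 
      (‖(rA s Y1 * Ψ s * rB s Y2) * (1 - TT (fun i => rB s (g i)))‖ + 
        ‖(1 - TT (fun i => rA s (g i))) * ((rA s Y1 * Ψ s * rB s Y2) * (1 - TT (fun i => rB s (g i))))‖)) l (𝓝 0) := by
    have h1 := f.midz0 K ((1 - t) * Y1) Y2 (by simp [hπt])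
    have h2 := f.midz0 K Y1 (Y2 * (1 - t)) (by simp [hπt])
    have h3 := f.midz0 K ((1 - t) * Y1) (Y2 * (1 - t)) (by simp [hπt])
    have h4 := h1.add (h2.add h3)
    rw [add_zero, add_zero] at h4
    refine h4.congr fun s => ?_
    rw [htA, htB]
    simp only [map_mul, map_sub, map_one, Matrix.mul_assoc]
  have D2 : Tendsto (fun s => ‖W0 (fun i => rA s (g i)) * (rA s Y1 * Ψ s * rB s Y2) * (W0 (fun i => rB s (g i)))ᴴ - tgt c (χ' s)‖) l (𝓝 0) := by
    have h1 : ∀ i j, Tendsto (fun s => ‖rA s (g i) * (rA s Y1 * Ψ s * rB s Y2) * (rB s (g j))ᴴ - c i j • χ' s‖) l (𝓝 0) := by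
      intro i j
      refine (f.midz K (g i * Y1) (Y2 * star (g j)) ((π Y1 * π Y2) i j • g i0) ?_).congr fun s => ?_
      · simp only [map_mul, map_smul, map_star, hg, Matrix.star_eq_conjTranspose, Matrix.conjTranspose_single, star_one]
        rw [Matrix.mul_assoc, ← Matrix.mul_assoc (π Y1), ← Matrix.mul_assoc, Matrix.single_mul_mul_single]
        simp
      · congr 1
        simp only [map_mul, map_smul, map_star, Matrix.star_eq_conjTranspose, Matrix.mul_assoc]
        congr 1
        simp only [χ', hc, Matrix.smul_apply, smul_smul, Matrix.smul_mul, smul_eq_mul]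
        congr 1
        have : ((Real.sqrt d : ℝ) : ℂ) ≠ 0 := by exact_mod_cast hsd
        push_cast
        field_simp
    have h2 := tendsto_finsetSum Finset.univ fun i _ => tendsto_finsetSum Finset.univ fun j _ => (h1 i j).pow 2
    have h3 := h2.sqrt
    simp only [ne_eq, OfNat.ofNat_ne_zero, not_false_eq_true, zero_pow, Finset.sum_const_zero, Real.sqrt_zero] at h3
    refine h3.congr fun s => ?_
    rw [← W0_tgt_sq, Real.sqrt_sq (norm_nonneg _)]
  have D3 : Tendsto (fun s => ‖tgt c (χ' s) - tgt c (χ s)‖) l (𝓝 0) := by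
    have h1 := ((hχ'.sub_const 1).abs).const_mul ‖c‖
    simp only [sub_self, abs_zero, mul_zero] at h1
    refine h1.congr fun s => ?_
    rw [tgt_smul_norm, hχd]
  have h4 := D1.add (D2.add D3)
  rw [add_zero, add_zero] at h4
  refine squeeze_zero (fun _ => norm_nonneg _) (fun s => ?_) h4
  set P := WW i0 (fun i => rA s (g i)) * (rA s Y1 * Ψ s * rB s Y2) * (WW i0 (fun i => rB s (g i)))ᴴ
  set Q := W0 (fun i => rA s (g i)) * (rA s Y1 * Ψ s * rB s Y2) * (W0 (fun i => rB s (g i)))ᴴ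
  have e : P - tgt c (χ s) = (P - Q) + ((Q - tgt c (χ' s)) + (tgt c (χ' s) - tgt c (χ s))) := by abel
  rw [e]
  refine (norm_add_le _ _).trans (add_le_add (WW_diff i0 _ _ _) (norm_add_le _ _))

end dil

end part9

section part10
open Filter Topology

attribute [local instance] Matrix.frobeniusNormedAddCommGroup Matrix.frobeniusNormedSpace

section mats
variable {m k m' k' : Type} [Fintype m] [Fintype k] [Fintype m'] [Fintype k']

def mat (ψ : m × k → ℂ) : Matrix m k ℂ := Matrix.of fun a b => ψ (a, b)

lemma kron_vec (A : Matrix m m' ℂ) (B : Matrix k k' ℂ) (ψ : m' × k' → ℂ) (y : m × k) :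
    ((A ⊗ₖ B).mulVec ψ) y = (A * mat ψ * Bᵀ) y.1 y.2 := by
  simp only [Matrix.mulVec, dotProduct, Matrix.mul_apply, Fintype.sum_prod_type, Matrix.kroneckerMap_apply, mat, Matrix.of_apply, Matrix.transpose_apply, Finset.sum_mul]
  rw [Finset.sum_comm]
  refine Finset.sum_congr rfl fun i _ => Finset.sum_congr rfl fun j _ => by ring

lemma mat_kron (A : Matrix m m' ℂ) (B : Matrix k k' ℂ) (ψ : m' × k' → ℂ) :
    mat ((A ⊗ₖ B).mulVec ψ) = A * mat ψ * Bᵀ := by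
  ext i j; simp only [mat, Matrix.of_apply, kron_vec]

lemma pinner_eq (v w : m × k → ℂ) : pinner v w = ip (mat w) (mat v) := by
  rw [ip_eq, pinner, Fintype.sum_prod_type]
  refine Finset.sum_congr rfl fun i _ => Finset.sum_congr rfl fun j _ => mul_comm _ _

lemma evnorm_eq (v : m × k → ℂ) : evnorm v = ‖mat v‖ := by
  rw [evnorm, Fintype.sum_prod_type]
  have := frob_sq (mat v)
  rw [← Real.sqrt_sq (norm_nonneg (mat v)), this]; rfl

lemma ip_add_right (X Y Z : Matrix m k ℂ) : ip X (Y + Z) = ip X Y + ip X Z := by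
  simp [ip, Matrix.mul_add]
lemma ip_sub_right (X Y Z : Matrix m k ℂ) : ip X (Y - Z) = ip X Y - ip X Z := by
  simp [ip, Matrix.mul_sub]
lemma ip_sub_left (X Y Z : Matrix m k ℂ) : ip (X - Y) Z = ip X Z - ip Y Z := by
  simp [ip, Matrix.sub_mul]
lemma ip_sum_right {α : Type} (s : Finset α) (X : Matrix m k ℂ) (Y : α → Matrix m k ℂ) : ip X (∑ a ∈ s, Y a) = ∑ a ∈ s, ip X (Y a) := by
  simp [ip, Matrix.mul_sum, Matrix.trace_sum]
lemma ip_sum_left {α : Type} (s : Finset α) (X : Matrix m k ℂ) (Y : α → Matrix m k ℂ) : ip (∑ a ∈ s, Y a) X = ∑ a ∈ s, ip (Y a) X := by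
  simp [ip, Matrix.sum_mul, Matrix.trace_sum, Matrix.conjTranspose_sum]
lemma ip_smul_right (X Y : Matrix m k ℂ) (c : ℂ) : ip X (c • Y) = c * ip X Y := by
  simp [ip]
lemma ip_smul_left (X Y : Matrix m k ℂ) (c : ℂ) : ip (c • X) Y = star c * ip X Y := by
  simp [ip]
lemma ip_mul_left (E : Matrix m m ℂ) (X Y : Matrix m k ℂ) : ip (E * X) Y = ip X (Eᴴ * Y) := by
  simp [ip, Matrix.mul_assoc]
lemma ip_mul_right (F : Matrix k k ℂ) (X Y : Matrix m k ℂ) : ip (X * F) Y = ip X (Y * Fᴴ) := by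
  simp only [ip, Matrix.conjTranspose_mul, Matrix.mul_assoc]
  rw [Matrix.trace_mul_comm]; simp only [Matrix.mul_assoc]

lemma psd_left {E : Matrix m m ℂ} (h : E.PosSemidef) (Y : Matrix m k ℂ) : 0 ≤ (ip Y (E * Y)).re := by
  have := (h.conjTranspose_mul_mul_same Y).trace_nonneg
  rw [Matrix.mul_assoc] at this
  exact (Complex.nonneg_iff.1 this).1

lemma psd_right {E : Matrix k k ℂ} (h : E.PosSemidef) (Y : Matrix m k ℂ) : 0 ≤ (ip Y (Y * E)).re := by
  have := (h.mul_mul_conjTranspose_same Y).trace_nonneg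
  rw [Matrix.trace_mul_comm] at this
  exact (Complex.nonneg_iff.1 this).1

variable [DecidableEq m] [DecidableEq k]
lemma psd_sq {E : Matrix m m ℂ} (h : E.PosSemidef) (h1 : (1 - E).PosSemidef) : (E - E * E).PosSemidef := by
  have e : E - E * E = E * (1 - E) * Eᴴ + (1 - E) * E * (1 - E)ᴴ := by
    rw [h1.1.eq, h.1.eq]; noncomm_ring
  rw [e]
  exact (h1.mul_mul_conjTranspose_same _).add (h.mul_mul_conjTranspose_same _)

lemma psd_sq1 {E : Matrix m m ℂ} (h : E.PosSemidef) (h1 : (1 - E).PosSemidef) : (1 - (E - E * E)).PosSemidef := by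
  have e : 1 - (E - E * E) = (1 - E) + Eᴴ * E := by
    rw [h.1.eq]; noncomm_ring
  rw [e]
  exact h1.add (Matrix.posSemidef_conjTranspose_mul_self _)

lemma sq_left {E : Matrix m m ℂ} (h : E.PosSemidef) (h1 : (1 - E).PosSemidef) (Y : Matrix m k ℂ) :
    ‖E * Y‖ ^ 2 ≤ (ip Y (E * Y)).re := by
  have h2 := psd_left (psd_sq h h1) Y
  have h3 := congrArg Complex.re (ip_self (E * Y))
  rw [ip_mul_left, h.1.eq, Complex.ofReal_re] at h3
  rw [Matrix.sub_mul, ip_sub_right, Complex.sub_re, Matrix.mul_assoc, h3] at h2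
  linarith

lemma sq_right {E : Matrix k k ℂ} (h : E.PosSemidef) (h1 : (1 - E).PosSemidef) (Y : Matrix m k ℂ) :
    ‖Y * E‖ ^ 2 ≤ (ip Y (Y * E)).re := by
  have h2 := psd_right (psd_sq h h1) Y
  have h3 := congrArg Complex.re (ip_self (Y * E))
  rw [ip_mul_right, h.1.eq, Complex.ofReal_re] at h3
  rw [Matrix.mul_sub, ip_sub_right, Complex.sub_re, ← Matrix.mul_assoc, h3] at h2
  linarith

lemma ct_left {E : Matrix m m ℂ} (h : E.PosSemidef) (h1 : (1 - E).PosSemidef) (Y : Matrix m k ℂ) :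
    ‖E * Y‖ ≤ ‖Y‖ := by
  have h2 := sq_left h h1 Y
  have h3 := psd_left h1 Y
  rw [Matrix.sub_mul, ip_sub_right, Complex.sub_re, Matrix.one_mul, ip_self, Complex.ofReal_re] at h3
  exact le_of_sq_le_sq (by linarith) (norm_nonneg _) 

lemma ct_right {E : Matrix k k ℂ} (h : E.PosSemidef) (h1 : (1 - E).PosSemidef) (Y : Matrix m k ℂ) :
    ‖Y * E‖ ≤ ‖Y‖ := by
  have h2 := sq_right h h1 Y
  have h3 := psd_right h1 Y
  rw [Matrix.mul_sub, ip_sub_right, Complex.sub_re, Matrix.mul_one, ip_self, Complex.ofReal_re] at h3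
  exact le_of_sq_le_sq (by linarith) (norm_nonneg _) 

lemma sy_id {E : Matrix m m ℂ} {F : Matrix k k ℂ} (h : E.PosSemidef) (hF : F.PosSemidef) (Y : Matrix m k ℂ) :
    ‖E * Y - Y * F‖ ^ 2 + (ip Y ((E - E * E) * Y)).re + (ip Y (Y * (F - F * F))).re = 
      (ip Y (E * Y * (1 - F))).re + (ip Y ((1 - E) * Y * F)).re := by
  have h3 := congrArg Complex.re (ip_self (E * Y - Y * F))
  rw [Complex.ofReal_re] at h3
  rw [← h3]
  have h4 : (ip (Y * F) (E * Y)).re = (ip (E * Y) (Y * F)).re := by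
    rw [← ip_conj, Complex.conj_re]
  simp only [ip_sub_left, ip_sub_right, Complex.sub_re, h4]
  simp only [ip_mul_left, ip_mul_right, h.1.eq, hF.1.eq, Matrix.sub_mul, Matrix.mul_sub, ip_sub_right, Complex.sub_re, Matrix.mul_one, Matrix.one_mul, Matrix.mul_assoc]
  ring

lemma sy_bd {E : Matrix m m ℂ} {F : Matrix k k ℂ} (h : E.PosSemidef) (h1 : (1 - E).PosSemidef) (hF : F.PosSemidef) (hF1 : (1 - F).PosSemidef) (Y : Matrix m k ℂ) :
    ‖E * Y - Y * F‖ ^ 2 ≤ (ip Y (E * Y * (1 - F))).re + (ip Y ((1 - E) * Y * F)).re ∧ 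
    ‖(E * E - E) * Y‖ ^ 2 ≤ (ip Y (E * Y * (1 - F))).re + (ip Y ((1 - E) * Y * F)).re := by
  rw [← sy_id h hF Y]
  have a := psd_left (psd_sq h h1) Y
  have b := psd_right (psd_sq hF hF1) Y
  have c := sq_left (psd_sq h h1) (psd_sq1 h h1) Y
  have e : ‖(E * E - E) * Y‖ = ‖(E - E * E) * Y‖ := by
    rw [← norm_neg, ← Matrix.neg_mul, neg_sub]
  rw [e]
  constructor
  · linarith
  · have := sq_nonneg ‖E * Y - Y * F‖
    linarith

end mats

end part10

section part11
open Filter Topology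

attribute [local instance] Matrix.frobeniusNormedAddCommGroup Matrix.frobeniusNormedSpace

lemma canonPair_transpose {d : ℕ} (M : Md d) (j : Fin 2) : (canonPair M j)ᵀ = canonPair Mᵀ j := by
  unfold canonPair; split_ifs <;> simp

/-- A two-outcome strategy together with its correlation. -/
structure Strat (n : ℕ) : Type where
  dA : ℕ
  dB : ℕ
  ψ : Fin dA × Fin dB → ℂ
  E : Fin n → Md dA
  F : Fin n → Md dB
  p : Fin n → Fin n → Fin 2 → Fin 2 → ℝ
  hψ : evnorm ψ = 1
  hE : ∀ v, (E v).PosSemidef ∧ (1 - E v).PosSemidef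
  hF : ∀ w, (F w).PosSemidef ∧ (1 - F w).PosSemidef
  hp : ∀ (v w : Fin n) (i j : Fin 2), (p v w i j : ℂ) =
          pinner ((canonPair (E v) i ⊗ₖ canonPair (F w) j).mulVec ψ) ψ

variable {n b d : ℕ} {x : ℝ} {Pt : Fin n → Md d}

namespace Strat
variable (s : Strat n)

def Ψ : Matrix (Fin s.dA) (Fin s.dB) ℂ := mat s.ψ
def F' (w : Fin n) : Md s.dB := (s.F w)ᵀ

lemma hF' (w : Fin n) : (s.F' w).PosSemidef ∧ (1 - s.F' w).PosSemidef := by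
  refine ⟨(s.hF w).1.transpose, ?_⟩
  have := (s.hF w).2.transpose
  rwa [Matrix.transpose_sub, Matrix.transpose_one] at this

lemma hp' (v w : Fin n) (i j : Fin 2) : (s.p v w i j : ℂ) = ip s.Ψ (canonPair (s.E v) i * s.Ψ * canonPair (s.F' w) j) := by
  rw [s.hp, pinner_eq, mat_kron, canonPair_transpose]; rfl

lemma hΨ : ‖s.Ψ‖ = 1 := by rw [← s.hψ, evnorm_eq]; rfl

lemma p00 (v w : Fin n) : (s.p v w 0 0 : ℂ) = ip (s.E v * s.Ψ) (s.Ψ * s.F' w) := by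
  rw [s.hp', ip_mul_left, (s.hE v).1.1.eq, ← Matrix.mul_assoc]; rfl

lemma p0 (v w : Fin n) : ((s.p v w 0 0 + s.p v w 0 1 : ℝ) : ℂ) = ip s.Ψ (s.E v * s.Ψ) := by
  rw [Complex.ofReal_add, s.hp', s.hp']
  simp [canonPair, ip_sub_right, Matrix.mul_sub]

lemma bds (v : Fin n) : ‖s.E v * s.Ψ - s.Ψ * s.F' v‖ ^ 2 ≤ s.p v v 0 1 + s.p v v 1 0 ∧ 
    ‖(s.E v * s.E v - s.E v) * s.Ψ‖ ^ 2 ≤ s.p v v 0 1 + s.p v v 1 0 := by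
  have h1 := congrArg Complex.re (s.hp' v v 0 1)
  have h2 := congrArg Complex.re (s.hp' v v 1 0)
  rw [Complex.ofReal_re] at h1 h2
  rw [h1, h2]
  exact sy_bd (s.hE v).1 (s.hE v).2 (s.hF' v).1 (s.hF' v).2 s.Ψ
end Strat

/-- ambient algebra -/
abbrev BB (n d : ℕ) : Type := ((s : Strat n) → Md s.dA × Md s.dB) × Md d

def gn (Pt : Fin n → Md d) (v : Fin n) : BB n d := (fun s => (s.E v, s.F' v), Pt v)

abbrev AA (Pt : Fin n → Md d) : StarSubalgebra ℂ (BB n d) := StarAlgebra.adjoin ℂ (Set.range (gn Pt))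

def gp (Pt : Fin n → Md d) (v : Fin n) : AA Pt := ⟨gn Pt v, StarAlgebra.subset_adjoin ℂ _ ⟨v, rfl⟩⟩

def mA (Pt : Fin n → Md d) (s : Strat n) : AA Pt →⋆ₐ[ℂ] Md s.dA where
  toFun a := (a.1.1 s).1
  map_one' := rfl
  map_mul' _ _ := rfl
  map_zero' := rfl
  map_add' _ _ := rfl
  commutes' _ := rfl
  map_star' _ := rfl

def mB (Pt : Fin n → Md d) (s : Strat n) : AA Pt →⋆ₐ[ℂ] Md s.dB where
  toFun a := (a.1.1 s).2
  map_one' := rfl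
  map_mul' _ _ := rfl
  map_zero' := rfl
  map_add' _ _ := rfl
  commutes' _ := rfl
  map_star' _ := rfl

def mπ (Pt : Fin n → Md d) : AA Pt →⋆ₐ[ℂ] Md d where
  toFun a := a.1.2
  map_one' := rfl
  map_mul' _ _ := rfl
  map_zero' := rfl
  map_add' _ _ := rfl
  commutes' _ := rfl
  map_star' _ := rfl

lemma gn_star (K : Canon n b d x Pt) (v : Fin n) : star (gn Pt v) = gn Pt v := by
  refine Prod.ext ?_ (K.sa v)
  funext s
  exact Prod.ext (s.hE v).1.1.eq (s.hF' v).1.1.eq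

lemma gp_gen (K : Canon n b d x Pt) : Algebra.adjoin ℂ (Set.range (gp Pt)) = ⊤ := by
  rw [eq_top_iff]
  rintro ⟨a, ha⟩ -
  have hs : star (Set.range (gn Pt)) = Set.range (gn Pt) := by
    ext y
    rw [Set.mem_star]
    constructor
    · rintro ⟨v, hv⟩; exact ⟨v, by rw [← gn_star K, hv, star_star]⟩
    · rintro ⟨v, rfl⟩; exact ⟨v, (gn_star K v).symm⟩
  have ha' : a ∈ Algebra.adjoin ℂ (Set.range (gn Pt)) := by
    have h := ha
    rw [← StarSubalgebra.mem_toSubalgebra, StarAlgebra.adjoin_toSubalgebra, hs, Set.union_self] at h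
    exact h
  clear hs
  suffices h : ∃ h : a ∈ AA Pt, (⟨a, h⟩ : AA Pt) ∈ Algebra.adjoin ℂ (Set.range (gp Pt)) from h.2
  clear ha
  induction ha' using Algebra.adjoin_induction with
  | mem y hy => obtain ⟨v, rfl⟩ := hy; exact ⟨(gp Pt v).2, Algebra.subset_adjoin ⟨v, rfl⟩⟩
  | algebraMap r => exact ⟨algebraMap_mem (AA Pt) r, Subalgebra.algebraMap_mem (Algebra.adjoin ℂ (Set.range (gp Pt))) r⟩
  | add y z _ _ hy hz => exact ⟨(AA Pt).add_mem hy.1 hz.1, Subalgebra.add_mem _ hy.2 hz.2⟩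
  | mul y z _ _ hy hz => exact ⟨(AA Pt).mul_mem hy.1 hz.1, Subalgebra.mul_mem _ hy.2 hz.2⟩

section canonvals
lemma mat_phid : mat (phid d) = (((Real.sqrt d)⁻¹ : ℝ) : ℂ) • (1 : Md d) := by
  ext i j
  simp [mat, phid, Matrix.one_apply]

lemma canon_val (hd : 0 < d) (A B : Md d) : pinner ((A ⊗ₖ Bᵀ).mulVec (phid d)) (phid d) = trd (A * B) := by
  have h : ((Real.sqrt d : ℝ) : ℂ) * ((Real.sqrt d : ℝ) : ℂ) = d := by
    rw [← Complex.ofReal_mul, Real.mul_self_sqrt (by positivity)]; simp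
  rw [pinner_eq, mat_kron, mat_phid, ip_smul_left, Matrix.transpose_transpose, Matrix.mul_smul, Matrix.smul_mul, ip_smul_right, Matrix.mul_one]
  simp only [ip, Matrix.conjTranspose_one, Matrix.one_mul, trd]
  have : star ((((Real.sqrt d)⁻¹ : ℝ) : ℂ)) = (((Real.sqrt d)⁻¹ : ℝ) : ℂ) := Complex.conj_ofReal _
  rw [this, ← mul_assoc, ← Complex.ofReal_mul, ← mul_inv, Real.mul_self_sqrt (by positivity)]
  push_cast
  rw [div_eq_inv_mul]
end canonvals

section fam2
variable {pt : Fin n → Fin n → Fin 2 → Fin 2 → ℝ}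

lemma pt_val (K : Canon n b d x Pt) (hpt : ∀ v w i j, (pt v w i j : ℂ) =
      pinner ((canonPair (Pt v) i ⊗ₖ canonPair ((Pt w)ᵀ) j).mulVec (phid d))
        (phid d)) (v w i j) : (pt v w i j : ℂ) = trd (canonPair (Pt v) i * canonPair (Pt w) j) := by
  rw [hpt, ← canonPair_transpose, canon_val K.hd]

def eta (pt : Fin n → Fin n → Fin 2 → Fin 2 → ℝ) (s : Strat n) : ℝ := dist1 s.p pt

def lf (pt : Fin n → Fin n → Fin 2 → Fin 2 → ℝ) : Filter (Strat n) := comap (eta pt) (𝓝 0)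

lemma p_tend (v w i j) : Tendsto (fun s : Strat n => s.p v w i j) (lf pt) (𝓝 (pt v w i j)) := by
  rw [tendsto_iff_norm_sub_tendsto_zero]
  refine squeeze_zero (fun _ => norm_nonneg _) (fun s => ?_) (tendsto_comap : Tendsto (eta pt) (lf pt) (𝓝 0))
  rw [Real.norm_eq_abs, eta, dist1]
  refine le_trans ?_ (Finset.single_le_sum (f := fun v => ∑ w, ∑ i, ∑ j, |s.p v w i j - pt v w i j|) (fun _ _ => by positivity) (Finset.mem_univ v))
  refine le_trans ?_ (Finset.single_le_sum (f := fun w => ∑ i, ∑ j, |s.p v w i j - pt v w i j|) (fun _ _ => by positivity) (Finset.mem_univ w))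
  refine le_trans ?_ (Finset.single_le_sum (f := fun i => ∑ j, |s.p v w i j - pt v w i j|) (fun _ _ => by positivity) (Finset.mem_univ i))
  exact Finset.single_le_sum (f := fun j => |s.p v w i j - pt v w i j|) (fun _ _ => by positivity) (Finset.mem_univ j)

lemma tend_of_sq {f g : Strat n → ℝ} {l : Filter (Strat n)} (h0 : ∀ s, 0 ≤ f s) (h : ∀ s, f s ^ 2 ≤ g s) (hg : Tendsto g l (𝓝 0)) :
    Tendsto f l (𝓝 0) := by
  have := (Real.continuous_sqrt.tendsto 0).comp hg
  rw [Real.sqrt_zero] at this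
  exact squeeze_zero h0 (fun s => Real.le_sqrt_of_sq_le (h s)) this

lemma theFam (K : Canon n b d x Pt) (hpt : ∀ v w i j, (pt v w i j : ℂ) =
      pinner ((canonPair (Pt v) i ⊗ₖ canonPair ((Pt w)ᵀ) j).mulVec (phid d))
        (phid d)) : Fam (lf pt) x Pt Strat.Ψ (mA Pt) (mB Pt) (mπ Pt) (gp Pt) := by
  have hv := pt_val K hpt
  have hz : ∀ v, Tendsto (fun s : Strat n => s.p v v 0 1 + s.p v v 1 0) (lf pt) (𝓝 0) := by
    intro v
    have h := (p_tend (pt := pt) v v 0 1).add (p_tend v v 1 0)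
    have e1 : pt v v 0 1 = 0 := by
      have := hv v v 0 1
      simp only [canonPair] at this
      simpa [Matrix.mul_sub, K.pp, trd] using this
    have e2 : pt v v 1 0 = 0 := by
      have := hv v v 1 0
      simp only [canonPair] at this
      simpa [Matrix.sub_mul, K.pp, trd] using this
    rwa [e1, e2, add_zero] at h
  have hsy : ∀ v, Tendsto (fun s : Strat n => ‖s.E v * s.Ψ - s.Ψ * s.F' v‖) (lf pt) (𝓝 0) := fun v =>
    tend_of_sq (fun _ => norm_nonneg _) (fun s => (s.bds v).1) (hz v)
  have htt : ∀ v, Tendsto (fun s : Strat n => ip s.Ψ (s.E v * s.Ψ)) (lf pt) (𝓝 (tv Pt v)) := by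
    intro v
    have h := (p_tend (pt := pt) v v 0 0).add (p_tend v v 0 1)
    have e : pt v v 0 0 + pt v v 0 1 = tv Pt v := by
      have : ((pt v v 0 0 + pt v v 0 1 : ℝ) : ℂ) = tv Pt v := by
        rw [Complex.ofReal_add, hv, hv, ← trd_add, ← Matrix.mul_add, ← K.trd_eq]
        simp [canonPair]
      exact_mod_cast this
    rw [e] at h
    have h' := (Complex.continuous_ofReal.tendsto _).comp h
    exact h'.congr fun s => s.p0 v v
  refine ⟨fun s => s.hΨ, fun v => Subtype.ext (gn_star K v), gp_gen K, fun v => rfl, fun s v Y => ct_left (s.hE v).1 (s.hE v).2 Y,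
    fun s v Y => ct_right (s.hF' v).1 (s.hF' v).2 Y, hsy, fun v => ?_, ?_, htt⟩
  · exact tend_of_sq (f := fun s : Strat n => ‖(s.E v * s.E v - s.E v) * s.Ψ‖) (fun _ => norm_nonneg _) (fun s => (s.bds v).2) (hz v)
  · have e : ∀ s : Strat n, mA Pt s (∑ v, gp Pt v - (x : ℂ) • 1) * s.Ψ = ∑ v, s.E v * s.Ψ - (x : ℂ) • s.Ψ := by
      intro s
      rw [map_sub, map_sum, map_smul, map_one, Matrix.sub_mul, Matrix.sum_mul, Matrix.smul_mul, Matrix.one_mul]; rfl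
    simp only [e]
    have hEE : ∀ v w, Tendsto (fun s : Strat n => ip (s.E v * s.Ψ) (s.E w * s.Ψ)) (lf pt) (𝓝 (trd (Pt v * Pt w))) := by
      intro v w
      have h1 : Tendsto (fun s : Strat n => ip (s.E v * s.Ψ) (s.E w * s.Ψ - s.Ψ * s.F' w)) (lf pt) (𝓝 0) := by
        refine squeeze_zero_norm (fun s => ?_) (hsy w)
        refine (ip_cs _ _).trans ?_
        have := ct_left (s.hE v).1 (s.hE v).2 s.Ψ
        rw [s.hΨ] at this
        exact mul_le_of_le_one_left (norm_nonneg _) this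
      have h2 := (Complex.continuous_ofReal.tendsto _).comp (p_tend (pt := pt) v w 0 0)
      rw [hv] at h2
      have h3 := h2.add h1
      rw [add_zero] at h3
      refine h3.congr fun s => ?_
      simp only [Function.comp]
      rw [s.p00, ← ip_add_right]; congr 1; abel
    have key : Tendsto (fun s : Strat n => ip (∑ v, s.E v * s.Ψ - (x : ℂ) • s.Ψ) (∑ v, s.E v * s.Ψ - (x : ℂ) • s.Ψ)) (lf pt) (𝓝 0) := by
      have hA := tendsto_finsetSum Finset.univ fun v _ => tendsto_finsetSum Finset.univ fun w _ => hEE v w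
      have hB := tendsto_finsetSum Finset.univ fun v _ => htt v
      have hC := (hA.sub (hB.const_mul (2 * (x : ℂ)))).add_const ((x : ℂ) * x)
      have e0 : ∑ v, ∑ w, trd (Pt v * Pt w) = (x : ℂ) * x := by
        have : ∑ v, ∑ w, trd (Pt v * Pt w) = trd ((∑ v, Pt v) * ∑ w, Pt w) := by
          simp only [trd, Matrix.sum_mul, Matrix.mul_sum, Matrix.trace_sum, Finset.sum_div]
          rw [Finset.sum_comm]
        rw [this, K.hsum]
        have hd0 : (d : ℂ) ≠ 0 := by exact_mod_cast K.hd.ne'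
        simp only [trd, Matrix.smul_mul, Matrix.one_mul, Matrix.trace_smul, Matrix.trace_one, smul_eq_mul, Fintype.card_fin]
        field_simp
      have e1 : ∑ v, (tv Pt v : ℂ) = x := by rw [← K.tv_sum]; push_cast; rfl
      rw [e0, e1] at hC
      have e2 : (x : ℂ) * x - 2 * x * x + x * x = 0 := by ring
      rw [e2] at hC
      refine hC.congr fun s => ?_
      have c1 : ∀ v, ip (s.E v * s.Ψ) s.Ψ = ip s.Ψ (s.E v * s.Ψ) := fun v => by
        rw [ip_mul_left, (s.hE v).1.1.eq]
      have c2 : ip s.Ψ s.Ψ = 1 := by rw [ip_self, s.hΨ]; simp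
      have c3 : star (x : ℂ) = x := Complex.conj_ofReal _
      simp only [ip_sub_left, ip_sub_right, ip_smul_left, ip_smul_right, ip_sum_left, ip_sum_right, c1, c2, c3]
      rw [Finset.sum_comm, Finset.sum_sub_distrib, ← Finset.mul_sum]
      ring
    refine tend_of_sq (fun _ => norm_nonneg _) (fun s => ?_) (by simpa using (Complex.continuous_re.tendsto _).comp key)
    simp only [Function.comp, ip_self, Complex.ofReal_re]
    exact le_rfl

end fam2

end part11

section part12
open Filter Topology

attribute [local instance] Matrix.frobeniusNormedAddCommGroup Matrix.frobeniusNormedSpace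

section fin
variable {n b d : ℕ} {x : ℝ} {Pt : Fin n → Md d} {pt : Fin n → Fin n → Fin 2 → Fin 2 → ℝ}

lemma evnorm_tgt {mA mB : ℕ} (M : Matrix (BI d mA) (BI d mB) ℂ) (c : Md d) (X : Matrix (Fin mA) (Fin mB) ℂ)
    (g : (Fin d × Fin d) × (Fin (mA + mA) × Fin (mB + mB)) → ℂ)
    (hg : ∀ i j a a', g ((i, j), (finSumFinEquiv a, finSumFinEquiv a')) = (M - tgt c X) (i, a) (j, a')) :
    evnorm g = ‖M - tgt c X‖ := by
  rw [evnorm, ← Real.sqrt_sq (norm_nonneg (M - tgt c X)), frob_sq]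
  congr 1
  simp only [Fintype.sum_prod_type]
  refine Finset.sum_congr rfl fun i _ => ?_
  rw [Finset.sum_comm, ← finSumFinEquiv.sum_comp]
  refine Finset.sum_congr rfl fun a _ => Finset.sum_congr rfl fun j _ => ?_
  rw [← finSumFinEquiv.sum_comp]
  exact Finset.sum_congr rfl fun a' _ => by rw [hg]

def vA {m : ℕ} (W : Matrix (BI d m) (Fin m) ℂ) : Matrix (Fin d × Fin (m + m)) (Fin m) ℂ :=
  W.submatrix (fun y => (y.1, finSumFinEquiv.symm y.2)) id

def vB {m : ℕ} (W : Matrix (BI d m) (Fin m) ℂ) : Matrix (Fin d × Fin (m + m)) (Fin m) ℂ :=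
  vA (W.map star)

lemma vA_iso {m : ℕ} (W : Matrix (BI d m) (Fin m) ℂ) (h : Wᴴ * W = 1) : (vA W)ᴴ * vA W = 1 := by
  rw [← h]
  ext i j
  simp only [Matrix.mul_apply, vA, Matrix.conjTranspose_apply, Matrix.submatrix_apply, id, Fintype.sum_prod_type]
  refine Finset.sum_congr rfl fun i _ => ?_
  rw [← finSumFinEquiv.sum_comp]
  simp

lemma vB_iso {m : ℕ} (W : Matrix (BI d m) (Fin m) ℂ) (h : Wᴴ * W = 1) : (vB W)ᴴ * vB W = 1 := by
  refine vA_iso _ ?_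
  have : (W.map star)ᴴ * W.map star = (Wᴴ * W).map star := by
    ext i j
    simp [Matrix.mul_apply]
  rw [this, h]
  ext i j
  simp [Matrix.one_apply, apply_ite]

def ch {mA mB : ℕ} (X : Matrix (Fin mA) (Fin mB) ℂ) (y : Fin (mA + mA) × Fin (mB + mB)) : ℂ :=
  Sum.elim (fun a => Sum.elim (fun a' => X a a') 0 (finSumFinEquiv.symm y.2)) 0 (finSumFinEquiv.symm y.1)

lemma ch_norm {mA mB : ℕ} (X : Matrix (Fin mA) (Fin mB) ℂ) : evnorm (ch X) = ‖X‖ := by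
  rw [evnorm, ← Real.sqrt_sq (norm_nonneg X), frob_sq]
  congr 1
  rw [Fintype.sum_prod_type, ← finSumFinEquiv.sum_comp]
  simp only [← (finSumFinEquiv (m := mB) (n := mB)).sum_comp]
  simp [ch, Fintype.sum_sum_type, -finSumFinEquiv_apply_left, -finSumFinEquiv_apply_right]

lemma core {mA mB : ℕ} (WA : Matrix (BI d mA) (Fin mA) ℂ) (WB : Matrix (BI d mB) (Fin mB) ℂ) 
    (X : Matrix (Fin mA) (Fin mB) ℂ) (ξ : Fin mA × Fin mB → ℂ) (ζ : Fin d × Fin d → ℂ) (Y : Matrix (Fin mA) (Fin mB) ℂ)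
    (hY : mat ξ = Y) (c : Md d) (hc : mat ζ = c) :
    evnorm (fun y : (Fin d × Fin d) × (Fin (mA + mA) × Fin (mB + mB)) =>
        ((vA WA ⊗ₖ vB WB).mulVec ξ) ((y.1.1, y.2.1), (y.1.2, y.2.2)) - ζ y.1 * ch X y.2) =
    ‖WA * Y * WBᴴ - tgt c X‖ := by
  refine evnorm_tgt _ _ _ _ fun i j a a' => ?_
  rw [kron_vec, hY, Matrix.sub_apply]
  congr 1
  · simp only [Matrix.mul_apply, vA, vB, Matrix.submatrix_apply, Matrix.transpose_apply, Matrix.conjTranspose_apply, Matrix.map_apply, id, Equiv.symm_apply_apply]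
  · rw [← hc]
    simp only [tgt, ch, mat, Matrix.of_apply, Equiv.symm_apply_apply]
    rfl

/-- all errors at a strategy bounded gives a local dilation -/
lemma dil_of {ε : ℝ} (s : Strat n) (WA : Matrix (BI d s.dA) (Fin s.dA) ℂ) (WB : Matrix (BI d s.dB) (Fin s.dB) ℂ)
    (X : Matrix (Fin s.dA) (Fin s.dB) ℂ) (hA : WAᴴ * WA = 1) (hB : WBᴴ * WB = 1) (hX : ‖X‖ = 1)
    (h0 : ‖WA * s.Ψ * WBᴴ - tgt ((((Real.sqrt d)⁻¹:ℝ):ℂ) • (1 : Md d)) X‖ ≤ ε)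
    (h1 : ∀ v w i j, ‖WA * (canonPair (s.E v) i * s.Ψ * canonPair (s.F' w) j) * WBᴴ - 
      tgt ((((Real.sqrt d)⁻¹:ℝ):ℂ) • (canonPair (Pt v) i * canonPair (Pt w) j)) X‖ ≤ ε) :
    IsLocalDilation ε (phid d) (fun v i => canonPair (Pt v) i)
        (fun w j => canonPair ((Pt w)ᵀ) j) s.ψ (fun v i => canonPair (s.E v) i)
        (fun w j => canonPair (s.F w) j) := by
  refine ⟨s.dA + s.dA, s.dB + s.dB, vA WA, vB WB, ch X, vA_iso _ hA, vB_iso _ hB, by rw [ch_norm, hX], ?_, fun v w i j => ?_⟩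
  · rw [core WA WB X s.ψ (phid d) s.Ψ rfl _ mat_phid]; exact h0
  · rw [core WA WB X _ _ _ (mat_kron _ _ _) _ (mat_kron _ _ _)]
    have := h1 v w i j
    rw [mat_phid, canonPair_transpose, canonPair_transpose, Matrix.transpose_transpose, Matrix.mul_smul, Matrix.smul_mul, Matrix.mul_one]
    exact this

def cY (Pt : Fin n → Md d) (v : Fin n) (i : Fin 2) : AA Pt := if i = 0 then gp Pt v else 1 - gp Pt v

lemma cY_A (v : Fin n) (i : Fin 2) (s : Strat n) : mA Pt s (cY Pt v i) = canonPair (s.E v) i := by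
  unfold cY canonPair; split_ifs <;> rfl
lemma cY_B (v : Fin n) (i : Fin 2) (s : Strat n) : mB Pt s (cY Pt v i) = canonPair (s.F' v) i := by
  unfold cY canonPair; split_ifs <;> rfl
lemma cY_π (v : Fin n) (i : Fin 2) : mπ Pt (cY Pt v i) = canonPair (Pt v) i := by
  unfold cY canonPair; split_ifs <;> rfl

lemma all_dil (K : Canon n b d x Pt) (hpt : ∀ v w i j, (pt v w i j : ℂ) =
      pinner ((canonPair (Pt v) i ⊗ₖ canonPair ((Pt w)ᵀ) j).mulVec (phid d))
        (phid d)) : ∃ e : Strat n → ℝ, Tendsto e (lf pt) (𝓝 0) ∧ ∀ s ε, e s ≤ ε → 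
    IsLocalDilation ε (phid d) (fun v i => canonPair (Pt v) i)
        (fun w j => canonPair ((Pt w)ᵀ) j) s.ψ (fun v i => canonPair (s.E v) i)
        (fun w j => canonPair (s.F w) j) := by
  obtain ⟨WA, WB, χ, hA, hB, hχ, hT⟩ := (theFam K hpt).dil K
  set e0 : Strat n → ℝ := fun s => ‖WA s * s.Ψ * (WB s)ᴴ - tgt ((((Real.sqrt d)⁻¹:ℝ):ℂ) • (1 : Md d)) (χ s)‖ with he0
  set e1 : Fin n → Fin n → Fin 2 → Fin 2 → Strat n → ℝ := fun v w i j s => ‖WA s * (canonPair (s.E v) i * s.Ψ * canonPair (s.F' w) j) * (WB s)ᴴ - 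
      tgt ((((Real.sqrt d)⁻¹:ℝ):ℂ) • (canonPair (Pt v) i * canonPair (Pt w) j)) (χ s)‖ with he1
  have t0 : Tendsto e0 (lf pt) (𝓝 0) := by
    have := hT 1 1
    simp only [map_one, Matrix.one_mul, Matrix.mul_one] at this
    exact this
  have t1 : ∀ v w i j, Tendsto (e1 v w i j) (lf pt) (𝓝 0) := by
    intro v w i j
    have := hT (cY Pt v i) (cY Pt w j)
    simp only [cY_A, cY_B, cY_π] at this
    exact this
  refine ⟨fun s => e0 s + ∑ v, ∑ w, ∑ i, ∑ j, e1 v w i j s, ?_, fun s ε h => ?_⟩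
  · have := t0.add (tendsto_finsetSum Finset.univ fun v _ => tendsto_finsetSum Finset.univ fun w _ =>
      tendsto_finsetSum Finset.univ fun i _ => tendsto_finsetSum Finset.univ fun j _ => t1 v w i j)
    simpa using this
  · have p0 : 0 ≤ e0 s := norm_nonneg _
    have p1 : ∀ v w i j, 0 ≤ e1 v w i j s := fun _ _ _ _ => norm_nonneg _
    have q3 : ∀ v w i, 0 ≤ ∑ j, e1 v w i j s := fun v w i => Finset.sum_nonneg fun j _ => p1 v w i j
    have q2 : ∀ v w, 0 ≤ ∑ i, ∑ j, e1 v w i j s := fun v w => Finset.sum_nonneg fun i _ => q3 v w i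
    have q1 : ∀ v, 0 ≤ ∑ w, ∑ i, ∑ j, e1 v w i j s := fun v => Finset.sum_nonneg fun i _ => q2 v i
    have q0 : 0 ≤ ∑ v, ∑ w, ∑ i, ∑ j, e1 v w i j s := Finset.sum_nonneg fun i _ => q1 i
    refine dil_of s (WA s) (WB s) (χ s) (hA s) (hB s) (hχ s) (le_trans ?_ h) fun v w i j => le_trans ?_ h
    · change e0 s ≤ _
      linarith
    · change e1 v w i j s ≤ _
      have r1 := Finset.single_le_sum (f := fun v => ∑ w, ∑ i, ∑ j, e1 v w i j s) (fun v _ => q1 v) (Finset.mem_univ v)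
      have r2 := Finset.single_le_sum (f := fun w => ∑ i, ∑ j, e1 v w i j s) (fun w _ => q2 v w) (Finset.mem_univ w)
      have r3 := Finset.single_le_sum (f := fun i => ∑ j, e1 v w i j s) (fun i _ => q3 v w i) (Finset.mem_univ i)
      have r4 := Finset.single_le_sum (f := fun j => e1 v w i j s) (fun j _ => p1 v w i j) (Finset.mem_univ j)
      linarith

lemma main_aux (K : Canon n b d x Pt) (hpt : ∀ v w i j, (pt v w i j : ℂ) =
      pinner ((canonPair (Pt v) i ⊗ₖ canonPair ((Pt w)ᵀ) j).mulVec (phid d))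
        (phid d)) : 
    (∀ s : Strat n, s.p = pt → IsLocalDilation 0 (phid d) (fun v i => canonPair (Pt v) i)
        (fun w j => canonPair ((Pt w)ᵀ) j) s.ψ (fun v i => canonPair (s.E v) i)
        (fun w j => canonPair (s.F w) j)) ∧
    ∀ ε : ℝ, 0 < ε → ∃ δ : ℝ, 0 < δ ∧ ∀ s : Strat n, dist1 s.p pt ≤ δ → 
      IsLocalDilation ε (phid d) (fun v i => canonPair (Pt v) i)
        (fun w j => canonPair ((Pt w)ᵀ) j) s.ψ (fun v i => canonPair (s.E v) i)
        (fun w j => canonPair (s.F w) j) := by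
  obtain ⟨e, he, hd⟩ := all_dil K hpt
  have key : ∀ ε : ℝ, 0 < ε → ∃ δ : ℝ, 0 < δ ∧ ∀ s : Strat n, dist1 s.p pt ≤ δ → e s ≤ ε := by
    intro ε hε
    have h := he.eventually (eventually_le_nhds hε)
    rw [lf, eventually_comap] at h
    obtain ⟨δ, hδ, h⟩ := Metric.eventually_nhds_iff.1 h
    refine ⟨δ / 2, by positivity, fun s hs => h (y := eta pt s) ?_ s rfl⟩
    have h0 : 0 ≤ eta pt s := by unfold eta dist1; positivity
    rw [Real.dist_eq, sub_zero, abs_of_nonneg h0]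
    have : eta pt s ≤ δ / 2 := hs
    linarith
  refine ⟨fun s hs => hd s 0 ?_, fun ε hε => ?_⟩
  · refine le_of_forall_pos_le_add fun ε hε => ?_
    obtain ⟨δ, hδ, h⟩ := key ε hε
    rw [zero_add]
    refine h s ?_
    rw [hs]; simp [dist1, hδ.le]
  · obtain ⟨δ, hδ, h⟩ := key ε hε
    exact ⟨δ, hδ, fun s hs => hd s ε (h s hs)⟩

end fin


end part12

theorem statement17 {n b d : ℕ} (hn : 3 ≤ n) (x : ℝ) (hx : x ∈ Lambda n)
    (hd : 0 < d) (hcop : Nat.Coprime b d) (hbd : x = (b : ℝ) / d)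
    (Pt : Fin n → Matrix (Fin d) (Fin d) ℂ)
    (hPt : ∀ v, IsProjection (Pt v)) (hPtsum : ∑ v, Pt v = (x : ℂ) • 1)
    (pt : Fin n → Fin n → Fin 2 → Fin 2 → ℝ)
    (hpt : ∀ v w i j, (pt v w i j : ℂ) =
      pinner ((canonPair (Pt v) i ⊗ₖ canonPair ((Pt w)ᵀ) j).mulVec (phid d))
        (phid d)) :
    (∀ {dA dB : ℕ} (ψ : Fin dA × Fin dB → ℂ)
        (E : Fin n → Matrix (Fin dA) (Fin dA) ℂ)
        (F : Fin n → Matrix (Fin dB) (Fin dB) ℂ),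
      evnorm ψ = 1 →
      (∀ v, (E v).PosSemidef ∧ (1 - E v).PosSemidef) →
      (∀ w, (F w).PosSemidef ∧ (1 - F w).PosSemidef) →
      (∀ (v w : Fin n) (i j : Fin 2),
        pinner ((canonPair (E v) i ⊗ₖ canonPair (F w) j).mulVec ψ) ψ =
          (pt v w i j : ℂ)) →
      IsLocalDilation 0 (phid d) (fun v i => canonPair (Pt v) i)
        (fun w j => canonPair ((Pt w)ᵀ) j) ψ (fun v i => canonPair (E v) i)
        (fun w j => canonPair (F w) j)) ∧
    ∀ ε : ℝ, 0 < ε → ∃ δ : ℝ, 0 < δ ∧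
      ∀ {dA dB : ℕ} (ψ : Fin dA × Fin dB → ℂ)
          (E : Fin n → Matrix (Fin dA) (Fin dA) ℂ)
          (F : Fin n → Matrix (Fin dB) (Fin dB) ℂ)
          (p : Fin n → Fin n → Fin 2 → Fin 2 → ℝ),
        evnorm ψ = 1 →
        (∀ v, (E v).PosSemidef ∧ (1 - E v).PosSemidef) →
        (∀ w, (F w).PosSemidef ∧ (1 - F w).PosSemidef) →
        (∀ (v w : Fin n) (i j : Fin 2), (p v w i j : ℂ) =
          pinner ((canonPair (E v) i ⊗ₖ canonPair (F w) j).mulVec ψ) ψ) →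
        dist1 p pt ≤ δ →
        IsLocalDilation ε (phid d) (fun v i => canonPair (Pt v) i)
          (fun w j => canonPair ((Pt w)ᵀ) j) ψ (fun v i => canonPair (E v) i)
          (fun w j => canonPair (F w) j) := by
  have K : Canon n b d x Pt := ⟨by omega, hd, hcop, hbd, fun v => (hPt v).1, fun v => (hPt v).2, hPtsum,
    lambda_arith hn x hx hd hcop hbd⟩
  obtain ⟨h1, h2⟩ := main_aux K hpt
  refine ⟨fun {dA dB} ψ E F hψ hE hF hp => h1 ⟨dA, dB, ψ, E, F, pt, hψ, hE, hF, fun v w i j => (hp v w i j).symm⟩ rfl, fun ε hε => ?_⟩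
  obtain ⟨δ, hδ, h⟩ := h2 ε hε
  exact ⟨δ, hδ, fun {dA dB} ψ E F p hψ hE hF hp hdist => h ⟨dA, dB, ψ, E, F, p, hψ, hE, hF, hp⟩ hdist⟩

end QST
end
end

section
/- Λ_4 equals the set {4k/(2k+1) : k = 0, 1, 2, …}, each such fraction being in lowest terms; and for every k ∈ ℕ there exist four projections P̃_{k,1}, P̃_{k,2}, P̃_{k,3}, P̃_{k,4} ∈ M_{2k+1}(ℂ), each of rank k, such that P̃_{k,1} + P̃_{k,2} + P̃_{k,3} + P̃_{k,4} = (4k/(2k+1))·I_{2k+1}. -/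
open scoped Matrix Kronecker ComplexOrder

noncomputable section
namespace QST

def pv (k p : ℕ) (s : ℝ) (i j : ℕ) : ℝ :=
  if i = 2 * j + p then Real.sqrt ((2 * k - i) / (2 * k + 1))
  else if i = 2 * j + p + 1 then s * Real.sqrt (i / (2 * k + 1)) else 0

def pV (k p : ℕ) (s : ℝ) : Matrix (Fin (2 * k + 1)) (Fin k) ℂ :=
  Matrix.of fun i j => ((pv k p s i j : ℝ) : ℂ)

lemma pv_orth (k p : ℕ) (hp : p ≤ 1) (s : ℝ) (hs : s * s = 1) (j j' : Fin k) :
    ∑ i : Fin (2 * k + 1), pv k p s i j * pv k p s i j' = if j = j' then 1 else 0 := by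
  have hj := j.2
  have hd : (0 : ℝ) < 2 * k + 1 := by positivity
  split_ifs with h
  · subst h
    have key : ∀ i : Fin (2 * k + 1), pv k p s i j * pv k p s i j =
        (if i = ⟨2 * j + p, by omega⟩ then (2 * (k : ℝ) - (2 * j + p)) / (2 * k + 1) else 0) +
        (if i = ⟨2 * j + p + 1, by omega⟩ then ((2 * j + p + 1 : ℝ)) / (2 * k + 1) else 0) := by
      intro i
      simp only [pv, Fin.ext_iff]
      by_cases h1 : (i : ℕ) = 2 * j + p
      · have h2 : ¬ ((i : ℕ) = 2 * j + p + 1) := by omega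
        have hle : ((i : ℕ) : ℝ) ≤ 2 * k := by exact_mod_cast (by omega : (i : ℕ) ≤ 2 * k)
        rw [if_pos h1, if_pos h1, if_neg h2, Real.mul_self_sqrt
          (div_nonneg (by linarith) hd.le), h1]
        push_cast; ring
      · by_cases h2 : (i : ℕ) = 2 * j + p + 1
        · rw [if_neg h1, if_pos h2, if_neg h1, if_pos h2, mul_mul_mul_comm, hs,
            Real.mul_self_sqrt (by positivity), h2]
          push_cast; ring
        · simp [h1, h2]
    rw [Finset.sum_congr rfl (fun i _ => key i), Finset.sum_add_distrib]
    simp only [Finset.sum_ite_eq', Finset.mem_univ, if_true]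
    field_simp
    ring
  · apply Finset.sum_eq_zero
    intro i _
    have h' : (j : ℕ) ≠ j' := fun e => h (Fin.ext e)
    unfold pv
    split_ifs <;> first | omega | simp

lemma pV_orth (k p : ℕ) (hp : p ≤ 1) (s : ℝ) (hs : s * s = 1) :
    (pV k p s)ᴴ * pV k p s = 1 := by
  ext j j'
  have := pv_orth k p hp s hs j j'
  rw [Matrix.mul_apply, Matrix.one_apply]
  simp only [Matrix.conjTranspose_apply, pV, Matrix.of_apply, RCLike.star_def, Complex.conj_ofReal]
  have h2 := congrArg Complex.ofReal this
  rw [apply_ite Complex.ofReal] at h2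
  simpa using h2

def pP (k p : ℕ) (s : ℝ) : Matrix (Fin (2 * k + 1)) (Fin (2 * k + 1)) ℂ :=
  pV k p s * (pV k p s)ᴴ

lemma pP_proj (k p : ℕ) (hp : p ≤ 1) (s : ℝ) (hs : s * s = 1) : IsProjection (pP k p s) := by
  constructor
  · simp [pP]
  · unfold pP
    rw [Matrix.mul_assoc, ← Matrix.mul_assoc _ (pV k p s), pV_orth k p hp s hs, Matrix.one_mul]

lemma pP_rank (k p : ℕ) (hp : p ≤ 1) (s : ℝ) (hs : s * s = 1) : (pP k p s).rank = k := by
  rw [pP, Matrix.rank_self_mul_conjTranspose, ← Matrix.rank_conjTranspose_mul_self,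
    pV_orth k p hp s hs, Matrix.rank_one, Fintype.card_fin]

lemma pv_pair (k p : ℕ) (i i' : ℕ) (hi : i ≤ 2 * k) (j : ℕ) :
    pv k p 1 i j * pv k p 1 i' j + pv k p (-1) i j * pv k p (-1) i' j =
      if i = i' then 2 * ((if i = 2 * j + p then (2 * (k : ℝ) - (i : ℝ)) / (2 * k + 1) else 0) +
        (if i = 2 * j + p + 1 then (i : ℝ) / (2 * k + 1) else 0)) else 0 := by
  have hd : (0 : ℝ) < 2 * k + 1 := by positivity
  have hle : (i : ℝ) ≤ 2 * k := by exact_mod_cast hi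
  have e1 := Real.mul_self_sqrt (div_nonneg (sub_nonneg.2 hle) hd.le)
  have e2 := Real.mul_self_sqrt (div_nonneg (Nat.cast_nonneg (α := ℝ) i) hd.le)
  by_cases h : i = i'
  · subst h
    unfold pv
    split_ifs <;> first | omega | linarith
  · unfold pv
    split_ifs <;> first | omega | ring

lemma pick (k i c : ℕ) (a : ℝ) (h : a ≠ 0 → i % 2 = c % 2 → c ≤ i ∧ i < 2 * k + c) :
    ∑ j : Fin k, (if i = 2 * (j : ℕ) + c then a else 0) = if i % 2 = c % 2 then a else 0 := by
  by_cases ha : a = 0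
  · simp [ha]
  split_ifs with hm
  · obtain ⟨h1, h2⟩ := h ha hm
    rw [Finset.sum_eq_single (⟨(i - c) / 2, by omega⟩ : Fin k)]
    · rw [if_pos]; simp only; omega
    · intro b _ hb
      rw [if_neg]
      intro e; apply hb; ext; simp only; omega
    · simp
  · apply Finset.sum_eq_zero
    intro j _
    rw [if_neg]; omega

lemma pv_sum (k i i' : ℕ) (hi : i ≤ 2 * k) :
    ∑ j : Fin k, pv k 0 1 i j * pv k 0 1 i' j + ∑ j : Fin k, pv k 0 (-1) i j * pv k 0 (-1) i' j +
    ∑ j : Fin k, pv k 1 1 i j * pv k 1 1 i' j + ∑ j : Fin k, pv k 1 (-1) i j * pv k 1 (-1) i' j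
      = if i = i' then 4 * (k : ℝ) / (2 * k + 1) else 0 := by
  have hd : (0 : ℝ) < 2 * k + 1 := by positivity
  rw [add_assoc, ← Finset.sum_add_distrib, ← Finset.sum_add_distrib]
  simp only [pv_pair k _ i i' hi]
  split_ifs with h
  · rw [← Finset.mul_sum, ← Finset.mul_sum, Finset.sum_add_distrib, Finset.sum_add_distrib]
    have x : ((2 * (k : ℝ) - i) / (2 * k + 1)) ≠ 0 → i < 2 * k := by
      intro h
      rcases lt_or_eq_of_le hi with h' | h'
      · exact h'
      · exact absurd (by rw [h']; simp) h
    have y : ((i : ℝ) / (2 * k + 1)) ≠ 0 → 0 < i := by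
      intro h
      rcases Nat.eq_zero_or_pos i with h' | h'
      · exact absurd (by rw [h']; simp) h
      · exact h'
    simp only [add_assoc]
    by_cases hm : i % 2 = 0
    · rw [pick k i 0 _ (fun h _ => by have := x h; omega),
        pick k i (0 + 1) _ (fun h _ => by have := y h; omega),
        pick k i 1 _ (fun h _ => by have := x h; omega),
        pick k i (1 + 1) _ (fun h _ => by have := y h; omega)]
      simp [hm]
      field_simp
      ring
    · have hm1 : i % 2 = 1 := by omega
      rw [pick k i 0 _ (fun h _ => by have := x h; omega),
        pick k i (0 + 1) _ (fun h _ => by have := y h; omega),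
        pick k i 1 _ (fun h _ => by have := x h; omega),
        pick k i (1 + 1) _ (fun h _ => by have := y h; omega)]
      simp [hm1]
      field_simp
      ring
  · simp

lemma lam_eq (l : ℕ) : lambdaSeq 4 l = 4 * (l : ℝ) / (2 * (l : ℝ) + 1) := by
  induction l with
  | zero => simp [lambdaSeq]
  | succ l ih =>
    rw [lambdaSeq, ih]
    have h1 : (2 * (l : ℝ) + 1) ≠ 0 := by positivity
    have h2 : (2 * (l : ℝ) + 3) ≠ 0 := by positivity
    have h3 : ((4 : ℕ) : ℝ) - 1 - 4 * l / (2 * l + 1) = (2 * l + 3) / (2 * l + 1) := by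
      field_simp; push_cast; ring
    have h4 : (2 * ((l + 1 : ℕ) : ℝ) + 1) = 2 * l + 3 := by push_cast; ring
    rw [h3, h4]
    field_simp
    push_cast
    ring

theorem statement18 :
    Lambda 4 = {x : ℝ | ∃ k : ℕ, x = 4 * (k : ℝ) / (2 * (k : ℝ) + 1)} ∧
    (∀ k : ℕ, Nat.Coprime (4 * k) (2 * k + 1)) ∧
    ∀ k : ℕ, ∃ P : Fin 4 → Matrix (Fin (2 * k + 1)) (Fin (2 * k + 1)) ℂ,
      (∀ v, IsProjection (P v)) ∧ (∀ v, (P v).rank = k) ∧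
      ∑ v, P v = ((4 * (k : ℝ) / (2 * (k : ℝ) + 1) : ℝ) : ℂ) • 1 := by
  refine ⟨?_, ?_, ?_⟩
  · ext x
    simp only [Lambda, Set.mem_ofPred_eq]
    rw [if_neg (by norm_num), Set.mem_range]
    simp only [lam_eq, eq_comm]
  · intro k
    have h2 : Nat.Coprime 2 (2 * k + 1) := by simp
    have hk : Nat.Coprime k (2 * k + 1) := by simp
    have := (h2.mul_left h2).mul_left hk
    simpa using this
  · intro k
    refine ⟨![pP k 0 1, pP k 0 (-1), pP k 1 1, pP k 1 (-1)], ?_, ?_, ?_⟩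
    · intro v
      fin_cases v <;> exact pP_proj k _ (by norm_num) _ (by norm_num)
    · intro v
      fin_cases v <;> exact pP_rank k _ (by norm_num) _ (by norm_num)
    · rw [Fin.sum_univ_four]
      ext i i'
      have := pv_sum k i i' (by omega)
      have := congrArg Complex.ofReal this
      rw [apply_ite Complex.ofReal] at this
      simp only [Complex.ofReal_add, Complex.ofReal_sum, Complex.ofReal_mul] at this
      simp only [Matrix.cons_val, Matrix.add_apply, pP, Matrix.mul_apply,
        Matrix.conjTranspose_apply, pV, Matrix.of_apply, RCLike.star_def, Complex.conj_ofReal,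
        Matrix.smul_apply, Matrix.one_apply, Fin.ext_iff]
      rw [this]
      split_ifs <;> simp

end QST
end
end
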